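/- arXiv:1310.8587 — 2 statements merged into one kernel-verified Lean document; each statement's English description precedes it below -/
import Mathlib

section
/- For the alternating group A_n, the Witten zeta function satisfies: for every s > 0, ζ^{A_n}(s) = Σ_{χ ∈ Irr(A_n)} χ(1)^{-s} → 1 as n → ∞. -/
/-- The set of irreducible characters of `G` over `ℂ`, as functions `G → ℂ`. -/
def IrrChar (G : Type) [Group G] [Fintype G] : Set (G → ℂ) :=
  {f | ∃ V : FDRep ℂ G, CategoryTheory.Simple V ∧ f = V.character}

namespace WittenAlt

open CategoryTheory

section General

variable {G : Type} [Group G] [Fintype G]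

lemma card_ne_zero' : (Nat.card G : ℂ) ≠ 0 := by
  exact_mod_cast Nat.card_pos.ne'

/-- Orthogonality of irreducible characters, distinct case. -/
lemma irr_orth {f f' : G → ℂ} (hf : f ∈ IrrChar G) (hf' : f' ∈ IrrChar G) (h : f ≠ f') :
    ∑ g, f g * f' g⁻¹ = 0 := by
  obtain ⟨V, hV, rfl⟩ := hf
  obtain ⟨W, hW, rfl⟩ := hf'
  have := invertibleOfNonzero (card_ne_zero' (G := G))
  have := FDRep.char_orthonormal V W
  rw [if_neg] at this
  · rcases mul_eq_zero.1 this with h0 | h0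
    · exact absurd (inv_eq_zero.1 h0) card_ne_zero'
    · exact h0
  · rintro ⟨i⟩
    exact h (FDRep.char_iso i)

lemma irr_norm {f : G → ℂ} (hf : f ∈ IrrChar G) : ∑ g, f g * f g⁻¹ = Nat.card G := by
  obtain ⟨V, hV, rfl⟩ := hf
  exact (FDRep.simple_iff_char_is_norm_one V).1 hV

lemma irr_conj {f : G → ℂ} (hf : f ∈ IrrChar G) (g h : G) : f (g * h) = f (h * g) := by
  obtain ⟨V, hV, rfl⟩ := hf
  exact FDRep.char_mul_comm V h g

/-- A family of irreducible characters that is detected by `L` has at most as many members as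
`L` has components. -/
lemma irr_count {ι : Type} [Fintype ι] (L : (G → ℂ) →ₗ[ℂ] (ι → ℂ)) (S : Finset (G → ℂ))
    (hS : ∀ f ∈ S, f ∈ IrrChar G)
    (hL : ∀ f : G → ℂ, (∀ g h, f (g * h) = f (h * g)) → L f = 0 →
      ∀ χ ∈ S, ∑ g, f g * χ g⁻¹ = 0) : S.card ≤ Fintype.card ι := by
  classical
  let M : (S → ℂ) →ₗ[ℂ] (G → ℂ) := Fintype.linearCombination ℂ (fun χ : S => (χ : G → ℂ))
  have hM : ∀ a, M a = ∑ χ : S, a χ • (χ : G → ℂ) := fun a => rfl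
  have hinj : Function.Injective (L ∘ₗ M) := by
    rw [← LinearMap.ker_eq_bot, LinearMap.ker_eq_bot']
    intro a ha
    have key := hL (M a) ?_ ha
    · funext χ
      have h1 := key χ χ.2
      have h2 : ∑ g, (M a) g * (χ : G → ℂ) g⁻¹
          = ∑ ψ : S, a ψ * ∑ g, (ψ : G → ℂ) g * (χ : G → ℂ) g⁻¹ := by
        simp only [hM, Finset.sum_apply, Pi.smul_apply, smul_eq_mul, Finset.sum_mul,
          Finset.mul_sum]
        rw [Finset.sum_comm]
        simp only [mul_assoc]
      rw [h2, Finset.sum_eq_single χ] at h1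
      · rw [irr_norm (hS χ χ.2)] at h1
        exact (mul_eq_zero.1 h1).resolve_right card_ne_zero'
      · intro ψ _ hne
        rw [irr_orth (hS ψ ψ.2) (hS χ χ.2) (fun h => hne (Subtype.ext h)), mul_zero]
      · simp
    · intro g h
      simp only [hM, Finset.sum_apply, Pi.smul_apply]
      exact Finset.sum_congr rfl fun ψ _ => by rw [irr_conj (hS ψ ψ.2)]
  have := LinearMap.finrank_le_finrank_of_injective hinj
  simpa using this

/-- Schur's lemma in concrete form. -/
lemma schur (V : FDRep ℂ G) [Simple V] (T : V →ₗ[ℂ] V) (hT : ∀ g, T ∘ₗ V.ρ g = V.ρ g ∘ₗ T) :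
    ∃ c : ℂ, T = c • LinearMap.id := by
  let φ : V ⟶ V := ⟨InducedCategory.homMk (ModuleCat.ofHom T), fun g => by
    ext1; ext x; exact LinearMap.congr_fun (hT g) x⟩
  have h1 := finrank_endomorphism_simple_eq_one ℂ V
  obtain ⟨c, hc⟩ := (finrank_eq_one_iff_of_nonzero' (𝟙 V) (id_nonzero V)).1 h1 φ
  refine ⟨c, ?_⟩
  have h2 : φ.hom.hom.hom = T := rfl
  rw [← h2, ← hc]
  rfl

/-- A class function whose right `H`-averages vanish is orthogonal to all irreducible characters
having a nonzero `H`-invariant vector. -/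
lemma orth_of_avg (V : FDRep ℂ G) [Simple V] (H : Subgroup G) (f : G → ℂ)
    (hf : ∀ g h, f (g * h) = f (h * g)) (hH : ∀ g, ∑ᶠ h : H, f (g * h) = 0)
    (v : V) (hv : v ≠ 0) (hinv : ∀ h ∈ H, V.ρ h v = v) :
    ∑ g, f g * V.character g⁻¹ = 0 := by
  classical
  let T : V →ₗ[ℂ] V := ∑ g, f g • V.ρ g⁻¹
  obtain ⟨c, hc⟩ := schur V T (by
    intro k
    change T * V.ρ k = V.ρ k * T
    simp only [T, Finset.sum_mul, Finset.mul_sum, smul_mul_assoc, mul_smul_comm, ← map_mul]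
    refine Fintype.sum_equiv (MulAut.conj k⁻¹).toEquiv _ _ ?_
    intro g
    have e : (MulAut.conj k⁻¹).toEquiv g = k⁻¹ * g * k := by simp
    rw [e, hf (k⁻¹ * g), mul_inv_cancel_left]
    congr 2
    group)
  have htr : ∑ g, f g * V.character g⁻¹ = LinearMap.trace ℂ V T := by
    simp [T, FDRep.character]
  have hTv : (Nat.card H : ℂ) • T v = 0 := by
    have h1 : ∀ h : H, T v = ∑ g, f (g * h) • V.ρ g⁻¹ v := by
      intro h
      simp only [T, LinearMap.sum_apply, LinearMap.smul_apply]
      refine Fintype.sum_equiv (Equiv.mulLeft (h : G)⁻¹) _ _ ?_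
      intro g
      simp only [Equiv.coe_mulLeft]
      rw [hf, mul_inv_cancel_left, mul_inv_rev, map_mul, inv_inv, Module.End.mul_apply,
        hinv h h.2]
    have h2 : (Nat.card H : ℂ) • T v = ∑ h : H, T v := by
      simp [Nat.card_eq_fintype_card, ← Nat.cast_smul_eq_nsmul ℂ]
    rw [h2, Finset.sum_congr rfl (fun h _ => h1 h), Finset.sum_comm]
    refine Finset.sum_eq_zero fun g _ => ?_
    rw [← Finset.sum_smul, ← finsum_eq_sum_of_fintype, hH, zero_smul]
  have hT0 : T v = 0 := (smul_eq_zero.1 hTv).resolve_left card_ne_zero'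
  rw [hc] at hT0
  have hc0 : c = 0 := (smul_eq_zero.1 hT0).resolve_right hv
  rw [htr, hc, hc0, zero_smul, map_zero]

lemma irr_one_mem : (fun _ => 1 : G → ℂ) ∈ IrrChar G := by
  refine ⟨FDRep.of (Representation.trivial ℂ G ℂ), ?_, ?_⟩
  · rw [FDRep.simple_iff_char_is_norm_one]
    simp [FDRep.character]
  · funext g
    simp [FDRep.character]

lemma irr_eq_one_of_trivial (V : FDRep ℂ G) [hV : Simple V] (h : ∀ g, V.ρ g = 1) :
    V.character = fun _ => 1 := by
  have h1 := (FDRep.simple_iff_char_is_norm_one V).1 hV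
  simp only [FDRep.character, h, LinearMap.trace_one] at h1
  simp only [Finset.sum_const, Finset.card_univ, nsmul_eq_mul, ← Nat.card_eq_fintype_card] at h1
  have h2 : (Module.finrank ℂ V : ℂ) * Module.finrank ℂ V = 1 :=
    mul_left_cancel₀ card_ne_zero' (by rw [h1, mul_one])
  have h3 : Module.finrank ℂ V = 1 := by
    have : Module.finrank ℂ V * Module.finrank ℂ V = 1 := by exact_mod_cast h2
    exact Nat.eq_one_of_mul_eq_one_left this
  funext g
  simp [FDRep.character, h, h3]

end General

end WittenAlt

namespace WittenAlt
open Equiv Equiv.Perm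

section Comb

variable {α : Type} [Fintype α] [DecidableEq α]

/-- Permutations supported on `C`. -/
def SC (C : Finset α) : Finset (Perm α) := Finset.univ.filter fun h => ∀ x, x ∉ C → h x = x


lemma mem_SC {C : Finset α} {h : Perm α} : h ∈ SC C ↔ ∀ x, x ∉ C → h x = x := by
  simp [SC]

lemma one_mem_SC (C : Finset α) : (1 : Perm α) ∈ SC C := by simp [mem_SC]

lemma mul_mem_SC {C : Finset α} {h k : Perm α} (hh : h ∈ SC C) (hk : k ∈ SC C) :
    h * k ∈ SC C := by
  rw [mem_SC] at *
  intro x hx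
  rw [Perm.mul_apply, hk x hx, hh x hx]

lemma inv_mem_SC {C : Finset α} {h : Perm α} (hh : h ∈ SC C) : h⁻¹ ∈ SC C := by
  rw [mem_SC] at *
  intro x hx
  rw [Perm.inv_eq_iff_eq, hh x hx]

lemma SC_mono {C D : Finset α} (hCD : C ⊆ D) {h : Perm α} (hh : h ∈ SC C) : h ∈ SC D := by
  rw [mem_SC] at *
  exact fun x hx => hh x fun h => hx (hCD h)

lemma conj_mem_SC {C : Finset α} {h : Perm α} (g : Perm α) (hh : h ∈ SC C) :
    g * h * g⁻¹ ∈ SC (C.image g) := by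
  rw [mem_SC] at *
  intro x hx
  rw [Perm.mul_apply, Perm.mul_apply, hh]
  · simp
  intro h
  exact hx (Finset.mem_image.2 ⟨_, h, by simp⟩)

lemma image_SC {C : Finset α} {h : Perm α} (hh : h ∈ SC C) : C.image h = C := by
  apply Finset.eq_of_subset_of_card_le
  · intro y hy
    obtain ⟨x, hx, rfl⟩ := Finset.mem_image.1 hy
    by_contra hn
    rw [mem_SC] at hh
    have := hh _ hn
    exact hn ((h.injective this).symm ▸ hx)
  · rw [Finset.card_image_of_injective _ h.injective]

lemma swap_mem_SC {C : Finset α} {a b : α} (ha : a ∈ C) (hb : b ∈ C) : swap a b ∈ SC C := by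
  rw [mem_SC]
  intro x hx
  exact swap_apply_of_ne_of_ne (fun h => hx (h ▸ ha)) (fun h => hx (h ▸ hb))

/-- Sum of `f` over the coset `g Sym(C)`. -/
def FS (f : Perm α → ℂ) (C : Finset α) (g : Perm α) : ℂ := ∑ h ∈ SC C, f (g * h)

lemma FS_right (f : Perm α → ℂ) {C : Finset α} (g : Perm α) {h : Perm α} (hh : h ∈ SC C) :
    FS f C (g * h) = FS f C g := by
  unfold FS
  refine Finset.sum_bij' (fun u _ => h * u) (fun u _ => h⁻¹ * u) ?_ ?_ ?_ ?_ ?_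
  · exact fun u hu => mul_mem_SC hh hu
  · exact fun u hu => mul_mem_SC (inv_mem_SC hh) hu
  · intro u _; simp
  · intro u _; simp
  · intro u _; rw [mul_assoc]

lemma FS_left (f : Perm α → ℂ) (hf : ∀ h u, sign h = 1 → f (h * u) = f (u * h))
    {C : Finset α} (g : Perm α) {h : Perm α} (hh : h ∈ SC C) (hs : sign h = 1) :
    FS f C (h * g) = FS f C g := by
  unfold FS
  refine Finset.sum_bij' (fun u _ => u * h) (fun u _ => u * h⁻¹) ?_ ?_ ?_ ?_ ?_
  · exact fun u hu => mul_mem_SC hu hh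
  · exact fun u hu => mul_mem_SC hu (inv_mem_SC hh)
  · intro u _; simp
  · intro u _; simp
  · intro u _; rw [mul_assoc, hf _ _ hs, mul_assoc]

lemma FS_conj (f : Perm α → ℂ) (hf : ∀ h u, sign h = 1 → f (h * u) = f (u * h))
    (C : Finset α) (g p : Perm α) (hs : sign p = 1) :
    FS f (C.image p) (p * g * p⁻¹) = FS f C g := by
  unfold FS
  refine Finset.sum_bij' (fun u _ => p⁻¹ * u * p) (fun u _ => p * u * p⁻¹) ?_ ?_ ?_ ?_ ?_
  · intro u hu
    have := conj_mem_SC p⁻¹ hu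
    rw [inv_inv, Finset.image_image] at this
    have e : (⇑p⁻¹ ∘ ⇑p) = id := by funext x; simp
    rwa [e, Finset.image_id] at this
  · exact fun u hu => conj_mem_SC p hu
  · intro u _; group
  · intro u _; group
  · intro u _
    rw [mul_assoc, mul_assoc, hf _ _ hs]
    congr 1

lemma decomp {C E D : Finset α} (hD : D = C ∪ E) {c : Perm α} (hc : c ∈ SC D)
    (hcE : C ∪ E.image c = D) (h2 : 1 < (C ∩ E).card) :
    ∃ h ∈ SC C, sign h = 1 ∧ ∃ k ∈ SC E, c = h * k := by
  have hE : ∀ y, y ∈ D → y ∉ C → y ∈ E := by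
    intro y hy hyC
    rw [hD] at hy
    exact (Finset.mem_union.1 hy).resolve_left hyC
  have hcE' : ∀ y, y ∈ D → y ∉ C → ∃ x ∈ E, c x = y := by
    intro y hy hyC
    rw [← hcE] at hy
    exact Finset.mem_image.1 ((Finset.mem_union.1 hy).resolve_left hyC)
  let e : {x : E // c x ∈ D ∧ c x ∉ C} ≃ {y : E // (y : α) ∈ D ∧ (y : α) ∉ C} :=
    { toFun := fun x => ⟨⟨c x, hE _ x.2.1 x.2.2⟩, x.2⟩
      invFun := fun y => ⟨⟨c⁻¹ y, by
          obtain ⟨x, hx, hxy⟩ := hcE' _ y.2.1 y.2.2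
          rw [← hxy]; simpa using hx⟩, by simpa using y.2⟩
      left_inv := fun x => by simp
      right_inv := fun y => by simp }
  let k0 : Perm α := Perm.ofSubtype e.extendSubtype
  have hk0 : k0 ∈ SC E := by
    rw [mem_SC]
    intro x hx
    exact Perm.ofSubtype_apply_of_not_mem _ hx
  have hk0' : ∀ x ∈ E, c x ∈ D → c x ∉ C → k0 x = c x := by
    intro x hx h1 h2
    have := e.extendSubtype_apply_of_mem ⟨x, hx⟩ ⟨h1, h2⟩
    simp only [k0]
    rw [Perm.ofSubtype_apply_of_mem _ hx, this]
    rfl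
  have hh0 : c * k0⁻¹ ∈ SC C := by
    rw [mem_SC] at *
    intro y hy
    rw [Perm.mul_apply]
    by_cases hyD : y ∈ D
    · obtain ⟨x, hx, rfl⟩ := hcE' y hyD hy
      have := hk0' x hx hyD hy
      rw [Perm.inv_eq_iff_eq.2 this.symm]
    · have hyE : y ∉ E := fun h => hyD (hD ▸ Finset.mem_union_right _ h)
      rw [Perm.inv_eq_iff_eq.2 (hk0 y hyE).symm, hc y hyD]
  rcases Int.units_eq_one_or (sign (c * k0⁻¹)) with hs | hs
  · exact ⟨_, hh0, hs, k0, hk0, by group⟩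
  · obtain ⟨a, ha, b, hb, hab⟩ := Finset.one_lt_card.1 h2
    rw [Finset.mem_inter] at ha hb
    refine ⟨c * k0⁻¹ * swap a b, mul_mem_SC hh0 (swap_mem_SC ha.1 hb.1), ?_,
      swap a b * k0, mul_mem_SC (swap_mem_SC ha.2 hb.2) hk0, ?_⟩
    · rw [Perm.sign_mul, hs, sign_swap hab]; rfl
    · have : swap a b * swap a b = 1 := swap_mul_self a b
      calc c = c * k0⁻¹ * (swap a b * swap a b) * k0 := by rw [this]; group
        _ = _ := by group

lemma vanish (f : Perm α → ℂ) (hf : ∀ h u, sign h = 1 → f (h * u) = f (u * h))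
    (k : ℕ) (hk : 2 * k + 2 ≤ Fintype.card α)
    (H : ∀ (C : Finset α) (g : Perm α), Cᶜ.card ≤ k → C.image g = C → FS f C g = 0) :
    ∀ (m m' : ℕ) (C : Finset α) (g : Perm α), Cᶜ.card ≤ k → Cᶜ.card ≤ m →
      (C ∪ C.image g).card ≤ m' → FS f C g = 0 := by
  intro m
  induction m with
  | zero =>
    intro m' C g hC hm _
    apply H C g hC
    have : C = Finset.univ := by
      rw [← Finset.compl_eq_empty_iff, ← Finset.card_eq_zero]; omega
    rw [this]
    exact Finset.image_univ_of_surjective g.surjective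
  | succ m ihm =>
    intro m'
    induction m' with
    | zero =>
      intro C g hC _ h0
      apply H C g hC
      have : C ∪ C.image g = ∅ := Finset.card_eq_zero.1 (by omega)
      have hCe : C = ∅ := (Finset.union_eq_empty.1 this).1
      simp [hCe]
    | succ m' ih =>
      intro C g hC hm hm'
      by_cases hgC : C.image g = C
      · exact H C g hC hgC
      set D := C ∪ C.image g with hD
      have hcardim : (C.image g).card = C.card := Finset.card_image_of_injective _ g.injective
      have hCD : C.card < D.card := by
        apply Finset.card_lt_card
        refine ⟨Finset.subset_union_left, fun hsub => hgC ?_⟩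
        exact Finset.eq_of_subset_of_card_le (Finset.subset_union_right.trans hsub) hcardim.ge
      have hcompl := Finset.card_add_card_compl C
      have hinter : 1 < (C ∩ C.image g).card := by
        have h1 := Finset.card_union_add_card_inter C (C.image g)
        have h2 : (C ∪ C.image g).card ≤ Fintype.card α := Finset.card_le_univ _
        omega
      have hsum : ∑ c ∈ SC D, FS f C (c * g) = 0 := by
        have h1 : ∑ c ∈ SC D, FS f C (c * g) = ∑ h ∈ SC C, FS f (D.image ⇑g⁻¹) g := by
          unfold FS
          rw [Finset.sum_comm]
          refine Finset.sum_congr rfl fun h hh => ?_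
          have hgh : g * h * g⁻¹ ∈ SC D :=
            SC_mono Finset.subset_union_right (conj_mem_SC g hh)
          refine Finset.sum_bij' (fun u _ => g⁻¹ * (u * (g * h * g⁻¹)) * g)
            (fun u _ => g * u * g⁻¹ * (g * h * g⁻¹)⁻¹) ?_ ?_ ?_ ?_ ?_
          · intro u hu
            have := conj_mem_SC g⁻¹ (mul_mem_SC hu hgh)
            rwa [inv_inv] at this
          · intro u hu
            refine mul_mem_SC ?_ (inv_mem_SC hgh)
            have := conj_mem_SC g hu
            have e : (⇑g ∘ ⇑g⁻¹) = id := by funext x; simp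
            rwa [Finset.image_image, e, Finset.image_id] at this
          · intro u _; group
          · intro u _; group
          · intro u _
            congr 1
            group
        rw [h1]
        refine Finset.sum_eq_zero fun h _ => ?_
        have hc' : (D.image ⇑g⁻¹).card = D.card :=
          Finset.card_image_of_injective _ (g⁻¹).injective
        have h3 := Finset.card_add_card_compl (D.image ⇑g⁻¹)
        refine ihm _ (D.image ⇑g⁻¹) g ?_ ?_ le_rfl <;> omega
      have hterm : ∀ c ∈ SC D, FS f C (c * g) =
          if C ∪ (C.image g).image c = D then FS f C g else 0 := by
        intro c hc
        split_ifs with hcD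
        · obtain ⟨h, hh, hs, k, hk, rfl⟩ := decomp hD hc hcD hinter
          have hk' : g⁻¹ * k * g ∈ SC C := by
            have := conj_mem_SC g⁻¹ hk
            have e : (⇑g⁻¹ ∘ ⇑g) = id := by funext x; simp
            rwa [inv_inv, Finset.image_image, e, Finset.image_id] at this
          have e2 : h * k * g = h * (g * (g⁻¹ * k * g)) := by group
          rw [e2, FS_left f hf _ hh hs, FS_right f _ hk']
        · apply ih C (c * g) hC hm
          have e3 : C.image (c * g) = (C.image g).image c := by
            rw [Finset.image_image]; rfl
          rw [e3]
          have hsub : C ∪ (C.image g).image c ⊆ D := by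
            refine Finset.union_subset Finset.subset_union_left ?_
            calc (C.image g).image c ⊆ D.image c :=
                  Finset.image_subset_image Finset.subset_union_right
              _ = D := image_SC hc
          have := Finset.card_lt_card (Finset.ssubset_iff_subset_ne.2 ⟨hsub, hcD⟩)
          omega
      rw [Finset.sum_congr rfl hterm, ← Finset.sum_filter, Finset.sum_const, nsmul_eq_mul,
        mul_eq_zero] at hsum
      refine hsum.resolve_left ?_
      rw [Nat.cast_eq_zero, Finset.card_eq_zero, ← ne_eq, ← Finset.nonempty_iff_ne_empty]
      refine ⟨1, Finset.mem_filter.2 ⟨one_mem_SC D, ?_⟩⟩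
      have : (⇑(1 : Perm α)) = id := rfl
      rw [this, Finset.image_id]

end Comb
end WittenAlt

namespace WittenAlt
open Equiv Equiv.Perm

section Comb2

variable {α : Type} [Fintype α] [DecidableEq α]

lemma FS_stab (f : Perm α → ℂ) (C : Finset α) (g : Perm α) (hg : C.image g = C) :
    ∃ σ : Perm {x // x ∉ C}, FS f C g = FS f C (ofSubtype σ) := by
  have hg' : ∀ x, g x ∉ C ↔ x ∉ C := by
    intro x
    rw [not_iff_not]
    constructor
    · intro h
      rw [← hg] at h
      obtain ⟨y, hy, hyx⟩ := Finset.mem_image.1 h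
      exact g.injective hyx ▸ hy
    · intro h
      rw [← hg]
      exact Finset.mem_image_of_mem _ h
  refine ⟨g.subtypePerm (p := fun x => x ∉ C) hg', ?_⟩
  have hmem : (ofSubtype (g.subtypePerm (p := fun x => x ∉ C) hg'))⁻¹ * g ∈ SC C := by
    rw [mem_SC]
    intro x hx
    rw [Perm.mul_apply, Perm.inv_eq_iff_eq, ofSubtype_apply_of_mem (p := fun x => x ∉ C) _ hx]
    rfl
  rw [← FS_right f (ofSubtype (g.subtypePerm (p := fun x => x ∉ C) hg')) hmem, mul_inv_cancel_left]

lemma FS_pair (f : Perm α → ℂ) (hf : ∀ h u, sign h = 1 → f (h * u) = f (u * h))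
    (C₁ C₂ : Finset α) (σ₁ : Perm {x // x ∉ C₁}) (σ₂ : Perm {x // x ∉ C₂})
    (hcard : C₁ᶜ.card = C₂ᶜ.card) (hc : σ₁.cycleType = σ₂.cycleType) (h2 : 1 < C₁.card) :
    FS f C₁ (ofSubtype σ₁) = FS f C₂ (ofSubtype σ₂) := by
  have hcard' : Fintype.card {x // x ∉ C₁} = Fintype.card {x // x ∉ C₂} := by
    rw [Fintype.card_subtype, Fintype.card_subtype]
    convert hcard using 2 <;> (ext; simp)
  let e : {x // x ∉ C₁} ≃ {x // x ∉ C₂} := Fintype.equivOfCardEq hcard'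
  have hct : (e.permCongr σ₁).cycleType = σ₂.cycleType := by
    rw [← hc]
    rw [← cycleType_ofSubtype (g := e.permCongr σ₁), ← cycleType_extendDomain e (g := σ₁)]
    congr 1
  obtain ⟨θ, hθ⟩ := isConj_iff.1 (isConj_iff_cycleType_eq.2 hct)
  have key : ∀ p : Perm α, sign p = 1 → (∀ x (hx : x ∉ C₁), p x = θ (e ⟨x, hx⟩)) →
      FS f C₁ (ofSubtype σ₁) = FS f C₂ (ofSubtype σ₂) := by
    intro p hs hp
    have himg : C₁.image p = C₂ := by
      have hsub : C₂ ⊆ C₁.image p := by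
        intro y hy
        refine Finset.mem_image.2 ⟨p⁻¹ y, ?_, by simp⟩
        by_contra hn
        have h1 := hp _ hn
        have h3 : p (p⁻¹ y) = y := by simp
        rw [h3] at h1
        exact (θ (e ⟨_, hn⟩)).2 (h1 ▸ hy)
      symm
      apply Finset.eq_of_subset_of_card_le hsub
      rw [Finset.card_image_of_injective _ p.injective]
      have := Finset.card_add_card_compl C₁
      have := Finset.card_add_card_compl C₂
      omega
    have hconj : p * ofSubtype σ₁ * p⁻¹ = ofSubtype σ₂ := by
      rw [mul_inv_eq_iff_eq_mul]
      ext x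
      rw [Perm.mul_apply, Perm.mul_apply]
      by_cases hx : x ∈ C₁
      · have hpx : p x ∈ C₂ := himg ▸ Finset.mem_image_of_mem _ hx
        rw [ofSubtype_apply_of_not_mem (p := fun x => x ∉ C₁) _ (not_not.2 hx),
          ofSubtype_apply_of_not_mem (p := fun x => x ∉ C₂) _ (not_not.2 hpx)]
      · rw [ofSubtype_apply_of_mem (p := fun x => x ∉ C₁) _ hx, hp _ (σ₁ ⟨x, hx⟩).2, hp x hx,
          ofSubtype_apply_coe, ← hθ]
        simp
    rw [← FS_conj f hf C₁ _ p hs, himg, hconj]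
  let p₀ : Perm α := (e.trans θ).extendSubtype
  have hp₀ : ∀ x (hx : x ∉ C₁), p₀ x = θ (e ⟨x, hx⟩) := by
    intro x hx
    exact (e.trans θ).extendSubtype_apply_of_mem x hx
  rcases Int.units_eq_one_or (sign p₀) with hs | hs
  · exact key p₀ hs hp₀
  · obtain ⟨a, ha, b, hb, hab⟩ := Finset.one_lt_card.1 h2
    refine key (p₀ * swap a b) ?_ ?_
    · rw [Perm.sign_mul, hs, sign_swap hab]; rfl
    · intro x hx
      rw [Perm.mul_apply, mem_SC.1 (swap_mem_SC ha hb) x hx, hp₀ x hx]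

/-- Extension by zero from the alternating group. -/
noncomputable def ext0 (f : alternatingGroup α → ℂ) (g : Perm α) : ℂ :=
  open Classical in if h : g ∈ alternatingGroup α then f ⟨g, h⟩ else 0

lemma ext0_even (f : alternatingGroup α → ℂ) (g : alternatingGroup α) : ext0 f g = f g := by
  unfold ext0
  rw [dif_pos g.2]

lemma ext0_class (f : alternatingGroup α → ℂ) (hf : ∀ g h, f (g * h) = f (h * g)) :
    ∀ h u, sign h = 1 → ext0 f (h * u) = ext0 f (u * h) := by
  intro h u hs
  by_cases hu : sign u = 1
  · have := hf ⟨h, mem_alternatingGroup.2 hs⟩ ⟨u, mem_alternatingGroup.2 hu⟩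
    rw [← ext0_even f, ← ext0_even f] at this
    exact this
  · unfold ext0
    rw [dif_neg, dif_neg] <;> simp [mem_alternatingGroup, hs, hu]

lemma ext0_add (f f' : alternatingGroup α → ℂ) (g : Perm α) :
    ext0 (f + f') g = ext0 f g + ext0 f' g := by
  unfold ext0
  split_ifs <;> simp

lemma ext0_smul (c : ℂ) (f : alternatingGroup α → ℂ) (g : Perm α) :
    ext0 (c • f) g = c * ext0 f g := by
  unfold ext0
  split_ifs <;> simp

/-- The even permutations supported on `C`. -/
def AC (C : Finset α) : Subgroup (alternatingGroup α) where
  carrier := {g | (g : Perm α) ∈ SC C}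
  one_mem' := one_mem_SC C
  mul_mem' := fun ha hb => mul_mem_SC ha hb
  inv_mem' := fun ha => inv_mem_SC ha

lemma mem_AC {C : Finset α} {g : alternatingGroup α} : g ∈ AC C ↔ (g : Perm α) ∈ SC C := Iff.rfl

lemma finsum_AC (f : alternatingGroup α → ℂ) (C : Finset α) (g : alternatingGroup α) :
    ∑ᶠ h : AC C, f (g * h) = FS (ext0 f) C g := by
  classical
  rw [finsum_eq_sum_of_fintype]
  unfold FS
  refine Finset.sum_of_injOn (fun h : AC C => ((h : alternatingGroup α) : Perm α)) ?_ ?_ ?_ ?_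
  · intro a _ b _ hab
    exact Subtype.ext (Subtype.ext hab)
  · intro a _
    exact a.2
  · intro h hh hn
    by_cases hs : sign h = 1
    · exact absurd ⟨⟨⟨h, mem_alternatingGroup.2 hs⟩, hh⟩, by simp, rfl⟩ hn
    · unfold ext0
      rw [dif_neg]
      have := mem_alternatingGroup.1 g.2
      simp [mem_alternatingGroup, hs, this]
  · intro h _
    rw [← ext0_even f]
    rfl

open Classical in
/-- The functional attached to a partition. -/
noncomputable def Lval (k : ℕ) (f : alternatingGroup α → ℂ)
    (i : Σ j : Fin (k + 1), Nat.Partition j) : ℂ :=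
  if h : ∃ q : Σ C : Finset α, Perm {x // x ∉ C},
      q.1ᶜ.card = i.1 ∧ q.2.partition.parts = i.2.parts then
    FS (ext0 f) h.choose.1 (ofSubtype h.choose.2) else 0

noncomputable def Llin (k : ℕ) : (alternatingGroup α → ℂ) →ₗ[ℂ]
    ((Σ j : Fin (k + 1), Nat.Partition j) → ℂ) where
  toFun f := Lval k f
  map_add' f f' := by
    funext i
    simp only [Lval, Pi.add_apply]
    split_ifs
    · simp [FS, ext0_add, Finset.sum_add_distrib]
    · simp
  map_smul' c f := by
    funext i
    simp only [Lval, Pi.smul_apply, RingHom.id_apply, smul_eq_mul]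
    split_ifs
    · simp [FS, ext0_smul, Finset.mul_sum]
    · simp

lemma count_level (k : ℕ) (hk : 2 * k + 2 ≤ Fintype.card α)
    (S : Finset (alternatingGroup α → ℂ))
    (hS : ∀ χ ∈ S, ∃ V : FDRep ℂ (alternatingGroup α), CategoryTheory.Simple V ∧
      χ = V.character ∧ ∃ C : Finset α, Cᶜ.card ≤ k ∧ ∃ v : V, v ≠ 0 ∧
        ∀ g : alternatingGroup α, (g : Perm α) ∈ SC C → V.ρ g v = v) :
    S.card ≤ ∑ j ∈ Finset.range (k + 1), Fintype.card (Nat.Partition j) := by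
  have hcard : Fintype.card (Σ j : Fin (k + 1), Nat.Partition j)
      = ∑ j ∈ Finset.range (k + 1), Fintype.card (Nat.Partition j) := by
    rw [Fintype.card_sigma, Finset.sum_range]
  rw [← hcard]
  refine irr_count (Llin k) S ?_ ?_
  · intro χ hχ
    obtain ⟨V, hV, h, -⟩ := hS χ hχ
    exact ⟨V, hV, h⟩
  · intro f hf hL χ hχ
    obtain ⟨V, hV, rfl, C, hC, v, hv, hinv⟩ := hS χ hχ
    refine orth_of_avg V (AC C) f hf ?_ v hv hinv
    intro g
    rw [finsum_AC]
    refine vanish (ext0 f) (ext0_class f hf) k hk ?_ _ _ C g hC le_rfl le_rfl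
    intro C g hC hg
    obtain ⟨σ, hσ⟩ := FS_stab (ext0 f) C g hg
    rw [hσ]
    have hcσ : Fintype.card {x // x ∉ C} = Cᶜ.card := by
      rw [Fintype.card_subtype]
      congr 1; ext; simp
    let i : Σ j : Fin (k + 1), Nat.Partition j :=
      ⟨⟨Cᶜ.card, by omega⟩, ⟨σ.partition.parts, σ.partition.parts_pos,
        σ.partition.parts_sum.trans hcσ⟩⟩
    have hex : ∃ q : Σ C : Finset α, Perm {x // x ∉ C},
      q.1ᶜ.card = i.1 ∧ q.2.partition.parts = i.2.parts := ⟨⟨C, σ⟩, rfl, rfl⟩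
    have hLi : Lval k f i = 0 := congrFun hL i
    unfold Lval at hLi
    rw [dif_pos hex] at hLi
    rw [← hLi]
    obtain ⟨hq1, hq2⟩ := hex.choose_spec
    refine FS_pair _ (ext0_class f hf) _ _ _ _ hq1.symm ?_ ?_
    · have e1 := filter_parts_partition_eq_cycleType (σ := σ)
      have e2 := filter_parts_partition_eq_cycleType (σ := hex.choose.2)
      rw [hq2] at e2
      rw [← e1, ← e2]
    · have := Finset.card_add_card_compl C
      omega

lemma count_total (h2 : 2 ≤ Fintype.card α) (S : Finset (alternatingGroup α → ℂ))
    (hS : ∀ χ ∈ S, χ ∈ IrrChar (alternatingGroup α)) :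
    S.card ≤ 2 * Fintype.card (Nat.Partition (Fintype.card α)) := by
  classical
  obtain ⟨a, b, hab⟩ := Fintype.exists_pair_of_one_lt_card h2
  have hcard : Fintype.card (Bool × Nat.Partition (Fintype.card α))
      = 2 * Fintype.card (Nat.Partition (Fintype.card α)) := by
    rw [Fintype.card_prod, Fintype.card_bool]
  rw [← hcard]
  let rep : Nat.Partition (Fintype.card α) → Perm α := fun μ =>
    if h : ∃ σ : Perm α, σ.partition = μ then h.choose else 1
  let pt : Bool × Nat.Partition (Fintype.card α) → Perm α := fun i =>
    if i.1 then rep i.2 else swap a b * rep i.2 * swap a b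
  let L : (alternatingGroup α → ℂ) →ₗ[ℂ] (Bool × Nat.Partition (Fintype.card α) → ℂ) :=
    { toFun := fun f i => ext0 f (pt i)
      map_add' := fun f f' => by funext i; exact ext0_add _ _ _
      map_smul' := fun c f => by funext i; exact ext0_smul _ _ _ }
  refine irr_count L S hS ?_
  intro f hf hL χ _
  have hcl := ext0_class f hf
  have hpt : ∀ i, ext0 f (pt i) = 0 := fun i => congrFun hL i
  have hconj : ∀ p u : Perm α, sign p = 1 → ext0 f (p * u * p⁻¹) = ext0 f u := by
    intro p u hs
    rw [mul_assoc, hcl _ _ hs, mul_assoc, inv_mul_cancel, mul_one]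
  have h0 : ∀ g : alternatingGroup α, f g = 0 := by
    intro g
    rw [← ext0_even f]
    have hex : ∃ σ : Perm α, σ.partition = (g : Perm α).partition := ⟨g, rfl⟩
    have hrep : (rep (g : Perm α).partition).partition = (g : Perm α).partition := by
      simp only [rep]
      rw [dif_pos hex]
      exact hex.choose_spec
    obtain ⟨p, hp⟩ := isConj_iff.1 (partition_eq_of_isConj.2 hrep)
    rcases Int.units_eq_one_or (sign p) with hs | hs
    · have := hpt (true, (g : Perm α).partition)
      simp only [pt, if_true] at this
      rw [← hp, hconj _ _ hs, this]
    · have := hpt (false, (g : Perm α).partition)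
      have hs' : sign (p * swap a b) = 1 := by
        rw [Perm.sign_mul, hs, sign_swap hab]; rfl
      rw [← hconj _ _ hs'] at this
      rw [← this]
      conv_lhs => rw [← hp]
      congr 1
      have hsw : swap a b * swap a b = 1 := swap_mul_self a b
      simp only [pt, mul_inv_rev, swap_inv]
      simp [mul_assoc]
  exact Finset.sum_eq_zero fun g _ => by rw [h0, zero_mul]

end Comb2
end WittenAlt

namespace WittenAlt
open Equiv Equiv.Perm

section Reps

variable {α : Type} [Fintype α] [DecidableEq α]

lemma ofSubtype_mem_SC {C : Finset α} (g : Perm C) : ofSubtype g ∈ SC C := by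
  rw [mem_SC]
  intro x hx
  exact ofSubtype_apply_of_not_mem _ hx

lemma exists_ofSubtype {C : Finset α} {g : Perm α} (hg : g ∈ SC C) :
    ∃ g' : Perm C, ofSubtype g' = g := by
  have h1 : ∀ x, g x ∈ C ↔ x ∈ C := by
    intro x
    constructor
    · intro h
      by_contra hn
      rw [mem_SC.1 hg x hn] at h
      exact hn h
    · intro h
      have := Finset.mem_image_of_mem g h
      rwa [image_SC hg] at this
  refine ⟨g.subtypePerm h1, ofSubtype_subtypePerm h1 (fun x hx => ?_)⟩
  by_contra hn
  exact hx (mem_SC.1 hg x hn)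

lemma conj_in {C : Finset α} (hC : 5 ≤ C.card) {c d : Perm α} (hc : c ∈ SC C) (hd : d ∈ SC C)
    (hc3 : c.IsThreeCycle) (hd3 : d.IsThreeCycle) :
    ∃ k : alternatingGroup α, (k : Perm α) ∈ SC C ∧ (k : Perm α) * c * (k : Perm α)⁻¹ = d := by
  obtain ⟨c', rfl⟩ := exists_ofSubtype hc
  obtain ⟨d', rfl⟩ := exists_ofSubtype hd
  have hc' : c'.IsThreeCycle := by
    rw [IsThreeCycle, ← cycleType_ofSubtype (g := c')]; exact hc3
  have hd' : d'.IsThreeCycle := by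
    rw [IsThreeCycle, ← cycleType_ofSubtype (g := d')]; exact hd3
  have hcj : IsConj (⟨c', hc'.mem_alternatingGroup⟩ : alternatingGroup C)
      ⟨d', hd'.mem_alternatingGroup⟩ := by
    apply alternatingGroup.isConj_of
    · exact isConj_iff_cycleType_eq.2 (hc'.trans hd'.symm)
    · have := hc'.card_support
      simp only [Fintype.card_coe]
      simp only [this]
      omega
  obtain ⟨k, hk⟩ := isConj_iff.1 hcj
  refine ⟨⟨ofSubtype (k : Perm C), ?_⟩, ofSubtype_mem_SC _, ?_⟩
  · rw [mem_alternatingGroup, sign_ofSubtype]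
    exact mem_alternatingGroup.1 k.2
  · have := congrArg (fun x : alternatingGroup C => ofSubtype (x : Perm C)) hk
    simpa using this

variable {V : Type} [AddCommGroup V] [Module ℂ V]
  (ρ : alternatingGroup α →* (V →ₗ[ℂ] V))

/-- `Y` is stable under the even permutations supported on `C`. -/
def StableOn (C : Finset α) (Y : Submodule ℂ V) : Prop :=
  ∀ g : alternatingGroup α, (g : Perm α) ∈ SC C → ∀ y ∈ Y, ρ g y ∈ Y

/-- The even permutations supported on `C` fix `Y` pointwise. -/
def TrivOn (C : Finset α) (Y : Submodule ℂ V) : Prop :=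
  ∀ g : alternatingGroup α, (g : Perm α) ∈ SC C → ∀ y ∈ Y, ρ g y = y

lemma trivOn_of_threeCycles (C : Finset α) (Y : Submodule ℂ V)
    (h : ∀ g : alternatingGroup α, (g : Perm α) ∈ SC C → (g : Perm α).IsThreeCycle →
      ∀ y ∈ Y, ρ g y = y) : TrivOn ρ C Y := by
  let N0 : Subgroup (alternatingGroup α) :=
    { carrier := {g | ∀ y ∈ Y, ρ g y = y}
      one_mem' := by simp
      mul_mem' := by
        intro a b ha hb y hy
        rw [map_mul, Module.End.mul_apply, hb y hy, ha y hy]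
      inv_mem' := by
        intro a ha y hy
        have h1 := ha y hy
        conv_lhs => rw [← h1]
        rw [← Module.End.mul_apply, ← map_mul, inv_mul_cancel, map_one, Module.End.one_apply] }
  intro g hg y hy
  obtain ⟨g', hg'⟩ := exists_ofSubtype hg
  have hle : alternatingGroup C ≤ (N0.map (alternatingGroup α).subtype).comap ofSubtype := by
    rw [← closure_three_cycles_eq_alternating, Subgroup.closure_le]
    intro c hc
    have hc3 : (ofSubtype c : Perm α).IsThreeCycle := by
      rw [IsThreeCycle, cycleType_ofSubtype]; exact hc
    exact ⟨⟨ofSubtype c, hc3.mem_alternatingGroup⟩, fun y hy =>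
      h ⟨ofSubtype c, hc3.mem_alternatingGroup⟩ (ofSubtype_mem_SC c) hc3 y hy, rfl⟩
  have hs : g' ∈ alternatingGroup C := by
    rw [mem_alternatingGroup, ← sign_ofSubtype, hg']
    exact mem_alternatingGroup.1 g.2
  obtain ⟨x, hx, hxg⟩ := hle hs
  have : x = g := Subtype.ext (by rw [← hg']; exact hxg)
  exact this ▸ hx y hy

/-- Eigenspace of `ρ c` inside `Y`. -/
def eig (c : alternatingGroup α) (Y : Submodule ℂ V) (μ : ℂ) : Submodule ℂ V where
  carrier := {y | y ∈ Y ∧ ρ c y = μ • y}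
  zero_mem' := ⟨Y.zero_mem, by simp⟩
  add_mem' := fun ha hb => ⟨Y.add_mem ha.1 hb.1, by rw [map_add, ha.2, hb.2, smul_add]⟩
  smul_mem' := fun r a ha => ⟨Y.smul_mem r ha.1, by rw [map_smul, ha.2, smul_comm]⟩

lemma mem_eig {c : alternatingGroup α} {Y : Submodule ℂ V} {μ : ℂ} {y : V} :
    y ∈ eig ρ c Y μ ↔ y ∈ Y ∧ ρ c y = μ • y := Iff.rfl

lemma eig_decomp {c : alternatingGroup α} {Y : Submodule ℂ V} {ω : ℂ} (hω : ω ^ 2 + ω + 1 = 0)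
    (hc : c ^ 3 = 1) (hY : ∀ y ∈ Y, ρ c y ∈ Y) {y : V} (hy : y ∈ Y) :
    ∃ y₀ ∈ eig ρ c Y 1, ∃ y₁ ∈ eig ρ c Y ω, ∃ y₂ ∈ eig ρ c Y (ω ^ 2), y = y₀ + y₁ + y₂ := by
  have h3 : ρ c (ρ c (ρ c y)) = y := by
    rw [← Module.End.mul_apply, ← Module.End.mul_apply, ← map_mul, ← map_mul]
    have : c * c * c = 1 := by rw [← hc, pow_succ, pow_two]
    rw [this, map_one, Module.End.one_apply]
  have hω3 : ω ^ 3 = 1 := by linear_combination (ω - 1) * hω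
  have hcy := hY y hy
  have hccy := hY _ hcy
  have mk : ∀ μ : ℂ, μ ^ 3 = 1 →
      (1 / 3 : ℂ) • (y + μ ^ 2 • ρ c y + μ • ρ c (ρ c y)) ∈ eig ρ c Y μ := by
    intro μ hμ
    refine ⟨Y.smul_mem _ (Y.add_mem (Y.add_mem hy (Y.smul_mem _ hcy)) (Y.smul_mem _ hccy)), ?_⟩
    simp only [map_smul, map_add, h3]
    match_scalars <;>
      first | ring1 | linear_combination (1 / 3) * hμ | linear_combination (-1 / 3) * hμ
  refine ⟨_, mk 1 (by norm_num), _, mk ω hω3, _, mk (ω ^ 2) (by rw [← pow_mul, mul_comm,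
    pow_mul, hω3, one_pow]), ?_⟩
  match_scalars
  · ring
  · linear_combination (-1 / 3 : ℂ) * hω - (1 / 3 : ℂ) * ω * hω3
  · linear_combination (-1 / 3 : ℂ) * hω

lemma eig_swap {c τ : alternatingGroup α} {Y : Submodule ℂ V} {μ ν : ℂ} (hμν : μ * ν = 1)
    (hτ : τ * c * τ⁻¹ = c⁻¹) (hY : ∀ y ∈ Y, ρ τ y ∈ Y) {y : V} (hy : y ∈ eig ρ c Y μ) :
    ρ τ y ∈ eig ρ c Y ν := by
  refine ⟨hY y hy.1, ?_⟩
  have h1 : c * τ = τ * c⁻¹ := by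
    have := congrArg (fun x => x⁻¹ * τ) hτ
    simp only [mul_inv_rev, inv_inv] at this
    rw [← this]; group
  have h2 : ρ c⁻¹ y = ν • y := by
    have h3 : ρ c⁻¹ (ρ c y) = y := by
      rw [← Module.End.mul_apply, ← map_mul, inv_mul_cancel, map_one, Module.End.one_apply]
    rw [hy.2, map_smul] at h3
    calc ρ c⁻¹ y = (ν * μ) • ρ c⁻¹ y := by rw [mul_comm, hμν, one_smul]
      _ = ν • y := by rw [mul_smul, h3]
  rw [← Module.End.mul_apply, ← map_mul, h1, map_mul, Module.End.mul_apply, h2, map_smul]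

lemma rho_injective (g : alternatingGroup α) : Function.Injective (ρ g) := by
  intro x y hxy
  have := congrArg (ρ g⁻¹) hxy
  simpa only [← Module.End.mul_apply, ← map_mul, inv_mul_cancel, map_one, Module.End.one_apply]
    using this

variable [FiniteDimensional ℂ V]

lemma eig_finrank {c τ : alternatingGroup α} {Y : Submodule ℂ V} {ω : ℂ}
    (hω : ω ^ 2 + ω + 1 = 0)
    (hτ : τ * c * τ⁻¹ = c⁻¹) (hYτ : ∀ y ∈ Y, ρ τ y ∈ Y) :
    2 * Module.finrank ℂ (eig ρ c Y ω) ≤ Module.finrank ℂ Y := by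
  have hω3 : ω ^ 3 = 1 := by linear_combination (ω - 1) * hω
  have hmn : ω * ω ^ 2 = 1 := by rw [← hω3]; ring
  have hne : ω ≠ ω ^ 2 := by
    intro h
    have h0 : ω ≠ 0 := by rintro rfl; simp at hω
    have h1 : ω = 1 := by
      have : ω * (ω - 1) = 0 := by linear_combination -h
      exact sub_eq_zero.1 ((mul_eq_zero.1 this).resolve_left h0)
    rw [h1] at hω
    norm_num at hω
  have h1 : Module.finrank ℂ (eig ρ c Y ω) ≤ Module.finrank ℂ (eig ρ c Y (ω ^ 2)) := by
    have hmap : (eig ρ c Y ω).map (ρ τ) ≤ eig ρ c Y (ω ^ 2) := by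
      rintro _ ⟨y, hy, rfl⟩
      exact eig_swap ρ hmn hτ hYτ hy
    calc _ = Module.finrank ℂ ((eig ρ c Y ω).map (ρ τ)) :=
          (LinearEquiv.finrank_eq (Submodule.equivMapOfInjective _ (rho_injective ρ τ) _))
      _ ≤ _ := Submodule.finrank_mono hmap
  have h2 : eig ρ c Y ω ⊓ eig ρ c Y (ω ^ 2) = ⊥ := by
    rw [Submodule.eq_bot_iff]
    rintro y ⟨ha, hb⟩
    have h3 : (ω - ω ^ 2) • y = 0 := by rw [sub_smul, ← ha.2, ← hb.2, sub_self]
    exact (smul_eq_zero.1 h3).resolve_left (sub_ne_zero.2 hne)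
  have h4 := Submodule.finrank_sup_add_finrank_inf_eq (eig ρ c Y ω) (eig ρ c Y (ω ^ 2))
  rw [h2, finrank_bot] at h4
  have h5 : Module.finrank ℂ (eig ρ c Y ω ⊔ eig ρ c Y (ω ^ 2) : Submodule ℂ V)
      ≤ Module.finrank ℂ Y :=
    Submodule.finrank_mono (sup_le (fun y hy => hy.1) (fun y hy => hy.1))
  omega

lemma eig_ne_bot {c τ : alternatingGroup α} {Y : Submodule ℂ V} {ω : ℂ}
    (hω : ω ^ 2 + ω + 1 = 0) (hc : c ^ 3 = 1) (hY : ∀ y ∈ Y, ρ c y ∈ Y)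
    (hτ : τ * c * τ⁻¹ = c⁻¹) (hYτ : ∀ y ∈ Y, ρ τ y ∈ Y) (hnt : ∃ y ∈ Y, ρ c y ≠ y) :
    eig ρ c Y ω ≠ ⊥ := by
  intro hbot
  obtain ⟨y, hy, hne⟩ := hnt
  have hω3 : ω ^ 3 = 1 := by linear_combination (ω - 1) * hω
  obtain ⟨y₀, h0, y₁, h1, y₂, h2, rfl⟩ := eig_decomp ρ hω hc hY hy
  have e1 : y₁ = 0 := by rw [hbot] at h1; simpa using h1
  have e2 : y₂ = 0 := by
    have := eig_swap ρ (ν := ω) (by rw [← hω3]; ring) hτ hYτ h2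
    rw [hbot, Submodule.mem_bot] at this
    exact rho_injective ρ τ (by rw [this, map_zero])
  apply hne
  rw [e1, e2, add_zero, add_zero, h0.2, one_smul]

lemma step {C : Finset α} {Y : Submodule ℂ V} (hC : 5 ≤ C.card) (hnt : ¬ TrivOn ρ C Y) :
    ∃ P ⊆ C, P.card = 5 ∧ ∃ c τ : alternatingGroup α, (c : Perm α) ∈ SC P ∧ (τ : Perm α) ∈ SC P ∧
      (c : Perm α).IsThreeCycle ∧ c ^ 3 = 1 ∧ τ * c * τ⁻¹ = c⁻¹ ∧ ∃ y ∈ Y, ρ c y ≠ y := by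
  have : ∃ c : alternatingGroup α, (c : Perm α) ∈ SC C ∧ (c : Perm α).IsThreeCycle ∧
      ∃ y ∈ Y, ρ c y ≠ y := by
    by_contra! hcon
    exact hnt (trivOn_of_threeCycles ρ C Y hcon)
  obtain ⟨c, hcC, hc3, y, hy, hne⟩ := this
  have hsub : (c : Perm α).support ⊆ C := by
    intro x hx
    by_contra hn
    exact (mem_support.1 hx) (mem_SC.1 hcC x hn)
  obtain ⟨P, hP1, hP2, hP3⟩ := Finset.exists_subsuperset_card_eq hsub
    (by rw [hc3.card_support]; omega) hC
  have hcP : (c : Perm α) ∈ SC P := by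
    rw [mem_SC]
    intro x hx
    by_contra hn
    exact hx (hP1 (mem_support.2 hn))
  obtain ⟨τ, hτ1, hτ2⟩ := conj_in hP3.ge hcP (inv_mem_SC hcP) hc3 hc3.inv
  refine ⟨P, hP2, hP3, c, τ, hcP, hτ1, hc3, ?_, Subtype.ext hτ2, y, hy, hne⟩
  apply Subtype.ext
  have := pow_orderOf_eq_one (c : Perm α)
  rw [hc3.orderOf] at this
  exact this

lemma SC_commute {C P : Finset α} {g h : Perm α} (hg : g ∈ SC (C \ P)) (hh : h ∈ SC P) :
    g * h = h * g := by
  apply Perm.Disjoint.commute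
  intro x
  by_cases hx : x ∈ P
  · left
    exact mem_SC.1 hg x (by simp [hx])
  · right
    exact mem_SC.1 hh x hx

lemma eig_stable {C P : Finset α} {Y : Submodule ℂ V} (hY : StableOn ρ C Y)
    {c : alternatingGroup α} (hc : (c : Perm α) ∈ SC P) (μ : ℂ) :
    StableOn ρ (C \ P) (eig ρ c Y μ) := by
  intro g hg y hy
  refine ⟨hY g (SC_mono Finset.sdiff_subset hg) y hy.1, ?_⟩
  have hcomm : c * g = g * c := Subtype.ext (SC_commute hg hc).symm
  rw [← Module.End.mul_apply, ← map_mul, hcomm, map_mul, Module.End.mul_apply, hy.2, map_smul]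

lemma exists_omega : ∃ ω : ℂ, ω ^ 2 + ω + 1 = 0 := by
  obtain ⟨ω, hω⟩ := IsAlgClosed.exists_root
    (Polynomial.X ^ 2 + Polynomial.X + 1 : Polynomial ℂ) (by
      have : (Polynomial.X ^ 2 + Polynomial.X + 1 : Polynomial ℂ).degree = 2 := by
        compute_degree!
      rw [this]; decide)
  exact ⟨ω, by simpa [Polynomial.IsRoot] using hω⟩

/-- A representation of small degree has vectors fixed by a large alternating subgroup. -/
lemma big_fix : ∀ (l : ℕ) (C : Finset α) (Y : Submodule ℂ V), StableOn ρ C Y → Y ≠ ⊥ →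
    Module.finrank ℂ Y < 2 ^ (l + 1) → 5 * l + 5 ≤ C.card →
    ∃ C' ⊆ C, C.card ≤ C'.card + 5 * l ∧ ∃ v ∈ Y, v ≠ 0 ∧
      ∀ g : alternatingGroup α, (g : Perm α) ∈ SC C' → ρ g v = v := by
  obtain ⟨ω, hω⟩ := exists_omega
  intro l
  induction l with
  | zero =>
    intro C Y hY hY0 hd hC
    by_cases ht : TrivOn ρ C Y
    · obtain ⟨v, hv, hv0⟩ := Submodule.exists_mem_ne_zero_of_ne_bot hY0
      exact ⟨C, subset_rfl, by simp, v, hv, hv0, fun g hg => ht g hg v hv⟩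
    · obtain ⟨P, hPC, hP5, c, τ, hc, hτ, hc3, hcube, hconj, hex⟩ := step ρ (by omega) ht
      have hYc := hY c (SC_mono hPC hc)
      have hYτ := hY τ (SC_mono hPC hτ)
      have h1 := eig_finrank ρ hω hconj hYτ
      have h2 := eig_ne_bot ρ hω hcube hYc hconj hYτ hex
      have h3 : Module.finrank ℂ (eig ρ c Y ω) ≠ 0 := fun h => h2 (Submodule.finrank_eq_zero.1 h)
      omega
  | succ l ih =>
    intro C Y hY hY0 hd hC
    by_cases ht : TrivOn ρ C Y
    · obtain ⟨v, hv, hv0⟩ := Submodule.exists_mem_ne_zero_of_ne_bot hY0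
      exact ⟨C, subset_rfl, by simp, v, hv, hv0, fun g hg => ht g hg v hv⟩
    · obtain ⟨P, hPC, hP5, c, τ, hc, hτ, hc3, hcube, hconj, hex⟩ := step ρ (by omega) ht
      have hYc := hY c (SC_mono hPC hc)
      have hYτ := hY τ (SC_mono hPC hτ)
      have h1 := eig_finrank ρ hω hconj hYτ
      have h2 := eig_ne_bot ρ hω hcube hYc hconj hYτ hex
      have hcard := Finset.card_sdiff_add_card_eq_card hPC
      have hpow : 2 ^ (l + 1 + 1) = 2 * 2 ^ (l + 1) := by ring
      obtain ⟨C', hC', hcC', v, hv, hv0, hfix⟩ := ih (C \ P) (eig ρ c Y ω)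
        (eig_stable ρ hY hc ω) h2 (by omega) (by omega)
      exact ⟨C', hC'.trans Finset.sdiff_subset, by omega, v, hv.1, hv0, hfix⟩

/-- Nontrivial representations have large degree. -/
lemma big_dim : ∀ (t : ℕ) (C : Finset α) (Y : Submodule ℂ V), StableOn ρ C Y →
    ¬ TrivOn ρ C Y → 5 * t + 5 ≤ C.card → t ≤ Module.finrank ℂ Y := by
  obtain ⟨ω, hω⟩ := exists_omega
  have hω' : (ω ^ 2) ^ 2 + ω ^ 2 + 1 = 0 := by linear_combination (ω ^ 2 - ω + 1) * hω
  intro t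
  induction t with
  | zero => intros; omega
  | succ t ih =>
    intro C Y hY ht hC
    obtain ⟨P, hPC, hP5, c, τ, hc, hτ, hc3, hcube, hconj, hex⟩ := step ρ (by omega) ht
    have hYc := hY c (SC_mono hPC hc)
    have hYτ := hY τ (SC_mono hPC hτ)
    have hcard := Finset.card_sdiff_add_card_eq_card hPC
    have hpos : 0 < Module.finrank ℂ Y := by
      have h1 := eig_finrank ρ hω hconj hYτ
      have h2 := eig_ne_bot ρ hω hcube hYc hconj hYτ hex
      have h3 : Module.finrank ℂ (eig ρ c Y ω) ≠ 0 := fun h => h2 (Submodule.finrank_eq_zero.1 h)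
      omega
    have hstep : ∀ μ, Module.finrank ℂ (eig ρ c Y μ) < Module.finrank ℂ Y →
        ¬ TrivOn ρ (C \ P) (eig ρ c Y μ) → t + 1 ≤ Module.finrank ℂ Y := by
      intro μ h1 h2
      have := ih (C \ P) (eig ρ c Y μ) (eig_stable ρ hY hc μ) h2 (by omega)
      omega
    by_contra hlt
    have t1 : TrivOn ρ (C \ P) (eig ρ c Y 1) := by
      by_contra h
      refine hlt (hstep 1 ?_ h)
      apply Submodule.finrank_lt_finrank_of_lt
      refine lt_of_le_of_ne (fun y hy => hy.1) ?_
      intro heq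
      obtain ⟨y, hy, hne⟩ := hex
      rw [← heq] at hy
      exact hne (by rw [hy.2, one_smul])
    have t2 : TrivOn ρ (C \ P) (eig ρ c Y ω) := by
      by_contra h
      have := eig_finrank ρ hω hconj hYτ
      exact hlt (hstep ω (by omega) h)
    have t3 : TrivOn ρ (C \ P) (eig ρ c Y (ω ^ 2)) := by
      by_contra h
      have := eig_finrank ρ hω' hconj hYτ
      exact hlt (hstep (ω ^ 2) (by omega) h)
    have tY : TrivOn ρ (C \ P) Y := by
      intro g hg y hy
      obtain ⟨y₀, h0, y₁, h1, y₂, h2, rfl⟩ := eig_decomp ρ hω hcube hYc hy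
      rw [map_add, map_add, t1 g hg _ h0, t2 g hg _ h1, t3 g hg _ h2]
    obtain ⟨a, ha, b, hb, d, hd, hab, had, hbd⟩ :=
      Finset.two_lt_card.1 (show 2 < (C \ P).card by omega)
    have h3c : (swap a b * swap a d).IsThreeCycle := isThreeCycle_swap_mul_swap_same hab had hbd
    have hmem : swap a b * swap a d ∈ SC (C \ P) :=
      mul_mem_SC (swap_mem_SC ha hb) (swap_mem_SC ha hd)
    obtain ⟨k, hk1, hk2⟩ := conj_in (by omega) (SC_mono hPC hc)
      (SC_mono Finset.sdiff_subset hmem) hc3 h3c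
    obtain ⟨y, hy, hne⟩ := hex
    apply hne
    have e := tY ⟨_, h3c.mem_alternatingGroup⟩ hmem (ρ k y) (hY k hk1 y hy)
    have hk3 : k * c * k⁻¹ = ⟨_, h3c.mem_alternatingGroup⟩ := Subtype.ext hk2
    rw [← hk3, ← Module.End.mul_apply, ← map_mul, inv_mul_cancel_right, map_mul,
      Module.End.mul_apply] at e
    exact rho_injective ρ k e

end Reps
end WittenAlt

namespace WittenAlt

section Partitions

lemma partition_ext {n : ℕ} {p q : n.Partition}
    (h : ∀ i ∈ Finset.Icc 1 n, p.parts.count i = q.parts.count i) : p = q := by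
  apply Nat.Partition.ext
  ext i
  by_cases hi : i ∈ Finset.Icc 1 n
  · exact h i hi
  · have key : ∀ r : n.Partition, r.parts.count i = 0 := by
      intro r
      rw [Multiset.count_eq_zero]
      intro hm
      apply hi
      rw [Finset.mem_Icc]
      exact ⟨r.parts_pos hm, r.parts_sum ▸ Multiset.le_sum_of_mem hm⟩
    rw [key p, key q]

lemma partition_sum {n : ℕ} (p : n.Partition) :
    ∑ i ∈ Finset.Icc 1 n, i * p.parts.count i = n := by
  conv_rhs => rw [← p.parts_sum]
  rw [Finset.sum_multiset_count_of_subset p.parts (Finset.Icc 1 n)]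
  · simp [mul_comm]
  · intro i hm
    rw [Multiset.mem_toFinset] at hm
    rw [Finset.mem_Icc]
    exact ⟨p.parts_pos hm, p.parts_sum ▸ Multiset.le_sum_of_mem hm⟩

lemma geom_fac {x : ℝ} (hx0 : 0 < x) (hx1 : x < 1) {i : ℕ} (hi : 1 ≤ i) (N : ℕ) :
    ∑ a ∈ Finset.range N, x ^ (i * a) ≤ Real.exp (x ^ i / (1 - x)) := by
  have hxi : x ^ i ≤ x := by
    calc x ^ i ≤ x ^ 1 := pow_le_pow_of_le_one hx0.le hx1.le hi
      _ = x := pow_one x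
  have hp : 0 < x ^ i := pow_pos hx0 i
  have h1 : ∑ a ∈ Finset.range N, x ^ (i * a) ≤ (1 - x ^ i)⁻¹ := by
    simp_rw [pow_mul]
    rw [← tsum_geometric_of_lt_one hp.le (by linarith)]
    exact (summable_geometric_of_lt_one hp.le (by linarith)).sum_le_tsum _
      (fun _ _ => pow_nonneg hp.le _)
  have h2 : (1 - x ^ i)⁻¹ ≤ 1 + x ^ i / (1 - x) := by
    have e : (1 - x ^ i)⁻¹ = 1 + x ^ i / (1 - x ^ i) := by
      have : 1 - x ^ i ≠ 0 := by linarith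
      field_simp
      ring
    rw [e]
    have : x ^ i / (1 - x ^ i) ≤ x ^ i / (1 - x) :=
      div_le_div_of_nonneg_left hp.le (by linarith) (by linarith)
    linarith
  have h3 := Real.add_one_le_exp (x ^ i / (1 - x))
  linarith

lemma partition_bound {x : ℝ} (hx0 : 0 < x) (hx1 : x < 1) (n : ℕ) :
    (Fintype.card n.Partition : ℝ) * x ^ n ≤ Real.exp ((1 - x)⁻¹ / (1 - x)) := by
  classical
  let I := Finset.Icc 1 n
  let T : Finset (I → ℕ) := Fintype.piFinset (fun _ => Finset.range (n + 1))
  let φ : n.Partition → (I → ℕ) := fun p i => p.parts.count i.1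
  have hφ : Function.Injective φ := by
    intro p q h
    exact partition_ext fun i hi => congrFun h ⟨i, hi⟩
  have hφs : ∀ p, ∑ i : I, i.1 * φ p i = n := by
    intro p
    rw [Finset.sum_coe_sort I (fun i => i * p.parts.count i)]
    exact partition_sum p
  have hφT : ∀ p, φ p ∈ T := by
    intro p
    rw [Fintype.mem_piFinset]
    intro i
    rw [Finset.mem_range, Nat.lt_succ_iff]
    have h1 := Finset.single_le_sum (f := fun i : I => i.1 * φ p i) (fun _ _ => Nat.zero_le _)
      (Finset.mem_univ i)
    rw [hφs] at h1
    have h2 : 1 ≤ i.1 := (Finset.mem_Icc.1 i.2).1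
    calc φ p i = 1 * φ p i := (one_mul _).symm
      _ ≤ i.1 * φ p i := Nat.mul_le_mul_right _ h2
      _ ≤ n := h1
  calc (Fintype.card n.Partition : ℝ) * x ^ n
      = ∑ p : n.Partition, ∏ i : I, x ^ (i.1 * φ p i) := by
        simp_rw [Finset.prod_pow_eq_pow_sum, hφs]
        simp
    _ = ∑ f ∈ Finset.univ.image φ, ∏ i : I, x ^ (i.1 * f i) := by
        rw [Finset.sum_image (fun a _ b _ h => hφ h)]
    _ ≤ ∑ f ∈ T, ∏ i : I, x ^ (i.1 * f i) := by
        apply Finset.sum_le_sum_of_subset_of_nonneg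
        · intro f hf
          obtain ⟨p, -, rfl⟩ := Finset.mem_image.1 hf
          exact hφT p
        · intro f _ _
          exact Finset.prod_nonneg fun i _ => pow_nonneg hx0.le _
    _ = ∏ i : I, ∑ a ∈ Finset.range (n + 1), x ^ (i.1 * a) := by
        rw [Finset.prod_univ_sum]
    _ ≤ ∏ i : I, Real.exp (x ^ i.1 / (1 - x)) := by
        apply Finset.prod_le_prod
        · intro i _
          exact Finset.sum_nonneg fun a _ => pow_nonneg hx0.le _
        · intro i _
          exact geom_fac hx0 hx1 (Finset.mem_Icc.1 i.2).1 _
    _ = Real.exp ((∑ i ∈ I, x ^ i) / (1 - x)) := by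
        rw [← Real.exp_sum, Finset.sum_div, Finset.sum_coe_sort I (fun i => x ^ i / (1 - x))]
    _ ≤ _ := by
        apply Real.exp_le_exp.2
        apply div_le_div_of_nonneg_right _ (by linarith)
        rw [← tsum_geometric_of_lt_one hx0.le hx1]
        exact (summable_geometric_of_lt_one hx0.le hx1).sum_le_tsum _
          (fun _ _ => pow_nonneg hx0.le _)

/-- The counting bound used at level `l`. -/
def Q (l : ℕ) : ℕ := 2 * ∑ j ∈ Finset.range (10 * l + 10), Fintype.card (Nat.Partition j)

lemma Q_summable {r : ℝ} (hr0 : 0 < r) (hr1 : r < 1) : Summable fun l => (Q l : ℝ) * r ^ l := by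
  obtain ⟨x, hx0, hx1, hx⟩ : ∃ x : ℝ, 0 < x ∧ x < 1 ∧ r < x ^ 11 := by
    have hc : Filter.Tendsto (fun x : ℝ => x ^ 11) (nhdsWithin 1 (Set.Iio 1)) (nhds 1) := by
      have : ContinuousAt (fun x : ℝ => x ^ 11) 1 := by fun_prop
      simpa using this.tendsto.mono_left nhdsWithin_le_nhds
    have h1 := hc.eventually (lt_mem_nhds hr1)
    have h2 : ∀ᶠ x : ℝ in nhdsWithin 1 (Set.Iio 1), x < 1 := self_mem_nhdsWithin
    have h3 : ∀ᶠ x : ℝ in nhdsWithin 1 (Set.Iio 1), 0 < x :=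
      nhdsWithin_le_nhds (lt_mem_nhds one_pos)
    obtain ⟨x, a, b, c⟩ := (h1.and (h2.and h3)).exists
    exact ⟨x, c, b, a⟩
  set K := Real.exp ((1 - x)⁻¹ / (1 - x))
  have hK : 0 < K := Real.exp_pos _
  have hq : r / x ^ 10 < x := by
    rw [div_lt_iff₀ (pow_pos hx0 _)]
    calc r < x ^ 11 := hx
      _ = _ := by ring
  have hq0 : 0 < r / x ^ 10 := div_pos hr0 (pow_pos hx0 _)
  have hQ : ∀ l, (Q l : ℝ) ≤ 2 * ((10 * l + 10) * (K / x ^ (10 * l + 10))) := by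
    intro l
    unfold Q
    push_cast
    apply mul_le_mul_of_nonneg_left _ (by norm_num)
    calc ∑ j ∈ Finset.range (10 * l + 10), (Fintype.card (Nat.Partition j) : ℝ)
        ≤ ∑ j ∈ Finset.range (10 * l + 10), K / x ^ (10 * l + 10) := by
          apply Finset.sum_le_sum
          intro j hj
          rw [Finset.mem_range] at hj
          rw [le_div_iff₀ (pow_pos hx0 _)]
          refine le_trans ?_ (partition_bound hx0 hx1 j)
          exact mul_le_mul_of_nonneg_left (pow_le_pow_of_le_one hx0.le hx1.le hj.le)
            (Nat.cast_nonneg _)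
      _ = _ := by simp
  have hsum : Summable fun l : ℕ => 20 * K / x ^ 10 * ((l : ℝ) ^ 1 * (r / x ^ 10) ^ l)
      + 20 * K / x ^ 10 * (r / x ^ 10) ^ l := by
    apply Summable.add
    · apply Summable.mul_left
      apply summable_pow_mul_geometric_of_norm_lt_one
      rw [Real.norm_eq_abs, abs_of_pos hq0]
      linarith
    · apply Summable.mul_left
      exact summable_geometric_of_lt_one hq0.le (by linarith)
  refine Summable.of_nonneg_of_le (fun l => by positivity) (fun l => ?_) hsum
  calc (Q l : ℝ) * r ^ l ≤ 2 * ((10 * l + 10) * (K / x ^ (10 * l + 10))) * r ^ l :=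
        mul_le_mul_of_nonneg_right (hQ l) (by positivity)
    _ = _ := by
      rw [div_pow, ← pow_mul, pow_add]
      field_simp
      ring

end Partitions
end WittenAlt

namespace WittenAlt
open Equiv Equiv.Perm

section Final

/-- The natural-number degree attached to a character. -/
noncomputable def deg {G : Type} [Group G] (f : G → ℂ) : ℕ := ⌊(f 1).re⌋₊

lemma deg_char {G : Type} [Group G] (V : FDRep ℂ G) :
    deg V.character = Module.finrank ℂ V := by
  simp [deg, FDRep.char_one]

lemma re_eq_deg {G : Type} [Group G] [Fintype G] {f : G → ℂ} (hf : f ∈ IrrChar G) :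
    (f 1).re = deg f := by
  obtain ⟨V, -, rfl⟩ := hf
  rw [deg_char]
  simp [FDRep.char_one]

lemma finrank_pos_of_simple {G : Type} [Group G] [Fintype G] (V : FDRep ℂ G)
    [CategoryTheory.Simple V] : 0 < Module.finrank ℂ V := by
  by_contra h
  have h0 : Module.finrank ℂ V = 0 := by omega
  have hs : Subsingleton V := Module.finrank_zero_iff.1 h0
  have h1 := irr_norm (f := V.character) ⟨V, inferInstance, rfl⟩
  have h2 : V.character = fun _ => 0 := by
    funext g
    have : V.ρ g = 0 := by
      ext v
      exact Subsingleton.elim _ _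
    rw [FDRep.character, this, map_zero]
  rw [h2] at h1
  simp at h1
  exact Fintype.card_ne_zero (α := G) (by exact_mod_cast h1.symm)

lemma deg_pos {G : Type} [Group G] [Fintype G] {f : G → ℂ} (hf : f ∈ IrrChar G) : 0 < deg f := by
  obtain ⟨V, hV, rfl⟩ := hf
  rw [deg_char]
  exact finrank_pos_of_simple V

lemma irr_finite (n : ℕ) (h2 : 2 ≤ n) : (IrrChar (alternatingGroup (Fin n))).Finite := by
  by_contra h
  obtain ⟨t, ht, hc⟩ := Set.Infinite.exists_subset_card_eq h
    (2 * Fintype.card (Nat.Partition (Fintype.card (Fin n))) + 1)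
  have := count_total (α := Fin n) (by simpa using h2) t (fun χ hχ => ht hχ)
  omega

lemma count_deg (n l : ℕ) (h2 : 2 ≤ n) (S : Finset (alternatingGroup (Fin n) → ℂ))
    (hS : ∀ χ ∈ S, χ ∈ IrrChar (alternatingGroup (Fin n))) (hd : ∀ χ ∈ S, deg χ < 2 ^ (l + 1)) :
    S.card ≤ Q l := by
  by_cases hn : 10 * l + 5 ≤ n
  · have h := count_level (α := Fin n) (5 * l) (by rw [Fintype.card_fin]; omega) S ?_
    · refine h.trans ?_
      unfold Q
      have : ∑ j ∈ Finset.range (5 * l + 1), Fintype.card (Nat.Partition j)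
          ≤ ∑ j ∈ Finset.range (10 * l + 10), Fintype.card (Nat.Partition j) :=
        Finset.sum_le_sum_of_subset (Finset.range_mono (by omega))
      omega
    · intro χ hχ
      obtain ⟨V, hV, rfl⟩ := hS χ hχ
      refine ⟨V, hV, rfl, ?_⟩
      have hdV := hd _ hχ
      rw [deg_char] at hdV
      have hpos := finrank_pos_of_simple V
      obtain ⟨C, -, hC, v, -, hv0, hv⟩ := big_fix (α := Fin n) V.ρ l Finset.univ ⊤
        (fun g _ y _ => Submodule.mem_top)
        (by
          intro h
          have h1 := finrank_top ℂ V
          rw [h, finrank_bot] at h1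
          omega)
        (by rw [finrank_top]; exact hdV) (by rw [Finset.card_univ, Fintype.card_fin]; omega)
      refine ⟨C, ?_, v, hv0, hv⟩
      rw [Finset.card_compl]
      rw [Finset.card_univ] at hC
      omega
  · have h := count_total (α := Fin n) (by rw [Fintype.card_fin]; omega) S hS
    refine h.trans ?_
    unfold Q
    rw [Fintype.card_fin]
    apply Nat.mul_le_mul_left
    exact Finset.single_le_sum (f := fun j => Fintype.card (Nat.Partition j))
      (fun _ _ => Nat.zero_le _) (Finset.mem_range.2 (by omega))

lemma min_deg (n t : ℕ) (hn : 5 * t + 5 ≤ n) {f : alternatingGroup (Fin n) → ℂ}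
    (hf : f ∈ IrrChar (alternatingGroup (Fin n))) (h1 : f ≠ fun _ => 1) : t ≤ deg f := by
  obtain ⟨V, hV, rfl⟩ := hf
  rw [deg_char, ← finrank_top ℂ V]
  refine big_dim (α := Fin n) V.ρ t Finset.univ ⊤ (fun g _ y _ => Submodule.mem_top) ?_
    (by rw [Finset.card_univ, Fintype.card_fin]; omega)
  intro h
  apply h1
  apply irr_eq_one_of_trivial
  intro g
  ext v
  exact h g (mem_SC.2 fun x hx => absurd (Finset.mem_univ x) hx) v Submodule.mem_top

lemma term_bound {s : ℝ} (hs : 0 < s) {d : ℕ} (hd : 0 < d) :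
    (d : ℝ) ^ (-s) ≤ ((2 : ℝ) ^ (-s)) ^ (Nat.log 2 d) := by
  have h : ((2 : ℝ) ^ (Nat.log 2 d)) ≤ d := by
    exact_mod_cast Nat.pow_log_le_self 2 hd.ne'
  calc (d : ℝ) ^ (-s) ≤ ((2 : ℝ) ^ (Nat.log 2 d)) ^ (-s) :=
        Real.rpow_le_rpow_of_nonpos (by positivity) h (by linarith)
    _ = _ := by
      rw [← Real.rpow_natCast, ← Real.rpow_natCast, ← Real.rpow_mul (by norm_num),
        ← Real.rpow_mul (by norm_num), mul_comm]

lemma sum_bound {s : ℝ} (hs : 0 < s) (n m : ℕ) (h2 : 2 ≤ n)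
    (S : Finset (alternatingGroup (Fin n) → ℂ))
    (hS : ∀ χ ∈ S, χ ∈ IrrChar (alternatingGroup (Fin n))) (hm : ∀ χ ∈ S, 2 ^ m ≤ deg χ) :
    ∑ f ∈ S, ((f 1).re) ^ (-s) ≤ ∑' l, (Q (l + m) : ℝ) * ((2 : ℝ) ^ (-s)) ^ (l + m) := by
  classical
  have hr0 : 0 < (2 : ℝ) ^ (-s) := Real.rpow_pos_of_pos (by norm_num) _
  have hr1 : (2 : ℝ) ^ (-s) < 1 := Real.rpow_lt_one_of_one_lt_of_neg (by norm_num) (by linarith)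
  set r := (2 : ℝ) ^ (-s)
  let φ : (alternatingGroup (Fin n) → ℂ) → ℕ := fun f => Nat.log 2 (deg f) - m
  have hφ : ∀ f ∈ S, Nat.log 2 (deg f) = φ f + m := by
    intro f hf
    have : m ≤ Nat.log 2 (deg f) := Nat.le_log_of_pow_le (by norm_num) (hm f hf)
    simp only [φ]
    omega
  have hsum : Summable fun l => (Q (l + m) : ℝ) * r ^ (l + m) :=
    (summable_nat_add_iff (f := fun l => (Q l : ℝ) * r ^ l) m).2 (Q_summable hr0 hr1)
  calc ∑ f ∈ S, ((f 1).re) ^ (-s) ≤ ∑ f ∈ S, r ^ (φ f + m) := by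
        apply Finset.sum_le_sum
        intro f hf
        rw [re_eq_deg (hS f hf), ← hφ f hf]
        exact term_bound hs (deg_pos (hS f hf))
    _ = ∑ l ∈ S.image φ, ∑ f ∈ S with φ f = l, r ^ (φ f + m) :=
        (Finset.sum_fiberwise_of_maps_to (fun f hf => Finset.mem_image_of_mem φ hf) _).symm
    _ ≤ ∑ l ∈ S.image φ, (Q (l + m) : ℝ) * r ^ (l + m) := by
        apply Finset.sum_le_sum
        intro l _
        have e : ∑ f ∈ S with φ f = l, r ^ (φ f + m)
            = ((S.filter fun f => φ f = l).card : ℝ) * r ^ (l + m) := by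
          rw [← nsmul_eq_mul]
          apply Finset.sum_eq_card_nsmul
          intro f hf
          rw [(Finset.mem_filter.1 hf).2]
        rw [e]
        apply mul_le_mul_of_nonneg_right _ (by positivity)
        exact_mod_cast count_deg n (l + m) h2 _ (fun χ hχ => hS χ (Finset.mem_filter.1 hχ).1)
          (fun χ hχ => by
            obtain ⟨hχS, hχl⟩ := Finset.mem_filter.1 hχ
            rw [← hχl, ← hφ χ hχS]
            exact Nat.lt_pow_succ_log_self (by norm_num) _)
    _ ≤ _ := hsum.sum_le_tsum _ (fun _ _ => by positivity)

lemma main (s : ℝ) (hs : 0 < s) :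
    Filter.Tendsto
      (fun n : ℕ => ∑ᶠ f ∈ IrrChar (alternatingGroup (Fin n)), ((f 1).re) ^ (-s))
      Filter.atTop (nhds 1) := by
  classical
  rw [Metric.tendsto_atTop]
  intro ε hε
  have ht := tendsto_sum_nat_add (fun l => (Q l : ℝ) * ((2 : ℝ) ^ (-s)) ^ l)
  obtain ⟨m, hm⟩ := (ht.eventually (gt_mem_nhds hε)).exists
  refine ⟨5 * 2 ^ m + 5, fun n hn => ?_⟩
  have h2 : 2 ≤ n := by omega
  have hfin := irr_finite n h2
  have h1 : (fun _ => 1 : alternatingGroup (Fin n) → ℂ) ∈ hfin.toFinset :=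
    hfin.mem_toFinset.2 irr_one_mem
  rw [finsum_mem_eq_finite_toFinset_sum _ hfin, ← Finset.add_sum_erase _ _ h1]
  have hb := sum_bound hs n m h2 (hfin.toFinset.erase fun _ => 1)
    (fun χ hχ => hfin.mem_toFinset.1 (Finset.mem_of_mem_erase hχ))
    (fun χ hχ => min_deg n (2 ^ m) hn (hfin.mem_toFinset.1 (Finset.mem_of_mem_erase hχ))
      (Finset.ne_of_mem_erase hχ))
  have h0 : 0 ≤ ∑ f ∈ hfin.toFinset.erase (fun _ => 1), ((f 1).re) ^ (-s) := by
    apply Finset.sum_nonneg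
    intro f hf
    rw [re_eq_deg (hfin.mem_toFinset.1 (Finset.mem_of_mem_erase hf))]
    positivity
  simp only [Complex.one_re, Real.one_rpow, Real.dist_eq, add_sub_cancel_left]
  rw [abs_of_nonneg h0]
  exact lt_of_le_of_lt hb hm

end Final
end WittenAlt

/-- Witten's zeta function of the alternating groups: for every `s > 0`,
`ζ^{A_n}(s) = Σ_{χ ∈ Irr(A_n)} χ(1)^{-s} → 1` as `n → ∞`. -/
theorem witten_zeta_alternating_tendsto_one (s : ℝ) (hs : 0 < s) :
    Filter.Tendsto
      (fun n : ℕ => ∑ᶠ f ∈ IrrChar (alternatingGroup (Fin n)), ((f 1).re) ^ (-s))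
      Filter.atTop (nhds 1) := by
  exact WittenAlt.main s hs
end

section
/- Let q ≥ 13 be a prime power and d = gcd(2, q−1). Suppose A, B ∈ PSL₂(q) are such that A, B, and AB all have order (q−1)/d, or all have order (q+1)/d. Then ⟨A, B⟩ = PSL₂(q), provided ⟨A,B⟩ is not contained in a dihedral, structural (Borel or cyclic), or A₄/S₄/A₅, or subfield subgroup — i.e., given the Dickson classification of subgroups of PSL₂(q), any subgroup containing three elements of order (q±1)/d whose product is 1 and which is not cyclic or dihedral must be all of PSL₂(q). -/
open Matrix

/-- The projective general linear group `PGL₂(K)`. -/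
abbrev ProjGL2 (K : Type) [Field K] : Type :=
  GeneralLinearGroup (Fin 2) K ⧸ Subgroup.center (GeneralLinearGroup (Fin 2) K)

/-- A subgroup of `PSL₂(q)` is structural if it fixes a line: all its elements lift to
matrices in `SL₂(q)` having a common eigenvector, i.e. it is conjugate into the Borel
subgroup of upper triangular matrices. -/
def IsStructural (F : Type) [Field F] [Fintype F]
    (H : Subgroup (ProjectiveSpecialLinearGroup (Fin 2) F)) : Prop :=
  ∃ v : Fin 2 → F, v ≠ 0 ∧ ∀ A : SpecialLinearGroup (Fin 2) F,
    (QuotientGroup.mk' (Subgroup.center (SpecialLinearGroup (Fin 2) F)) A) ∈ H →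
      ∃ c : F, (A : Matrix (Fin 2) (Fin 2) F).mulVec v = c • v

section Abstract
open MulAction
open scoped Classical

variable {H X : Type*} [Group H] [MulAction H X]

/-- Number of elements fixing exactly the point `x`, plus one. -/
noncomputable def uniCard (H : Type*) {X : Type*} [Group H] [MulAction H X] (x : X) : ℕ :=
  Nat.card {h : H // h ≠ 1 ∧ fixedBy X h = {x}} + 1

lemma fixedBy_conj_eq (g h : H) (x : X) :
    fixedBy X (g * h * g⁻¹) = {g • x} ↔ fixedBy X h = {x} := by
  simp only [Set.ext_iff, mem_fixedBy, Set.mem_singleton_iff]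
  constructor
  · intro k y
    have := k (g • y)
    simpa [mul_smul] using this
  · intro k y
    have := k (g⁻¹ • y)
    rw [mul_smul, mul_smul, ← eq_inv_smul_iff, this, inv_smul_eq_iff]

lemma uniCard_smul (g : H) (x : X) : uniCard H (g • x) = uniCard H x := by
  unfold uniCard
  congr 1
  refine (Nat.card_congr (Equiv.subtypeEquiv (MulAut.conj g).toEquiv ?_)).symm
  intro h
  simp only [MulEquiv.toEquiv_eq_coe, EquivLike.coe_coe, MulAut.conj_apply]
  rw [fixedBy_conj_eq]
  simp

lemma card_stab_smul [Finite H] (g : H) (x : X) :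
    Nat.card (stabilizer H (g • x)) = Nat.card (stabilizer H x) :=
  Nat.card_congr ((stabilizerEquivStabilizer (g := g⁻¹) (a := g • x) (b := x) (by simp)).toEquiv)

lemma double_count [Fintype H] [Fintype X]
    (hfix : ∀ h : H, h ≠ 1 → (fixedBy X h).ncard = 1 ∨ (fixedBy X h).ncard = 2) :
    ∑ x : X, ((Nat.card (stabilizer H x) : ℚ) + uniCard H x - 2) = 2 * Nat.card H - 2 := by
  have key : ∀ h ∈ (Finset.univ.erase (1 : H)),
      ∑ x : X, ((if h • x = x then (1:ℚ) else 0) + (if fixedBy X h = {x} then 1 else 0)) = 2 := by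
    intro h hh
    have hh : h ≠ 1 := by simpa using hh
    rw [Finset.sum_add_distrib]
    have e1 : ∑ x : X, (if h • x = x then (1:ℚ) else 0) = (fixedBy X h).ncard := by
      rw [Finset.sum_boole, Set.ncard_eq_toFinset_card']
      congr 2
      ext x; simp
    rw [e1]
    rcases hfix h hh with h1 | h1
    · obtain ⟨y, hy⟩ := Set.ncard_eq_one.mp h1
      rw [h1, hy]
      simp [Set.singleton_eq_singleton_iff]
      norm_num
    · rw [h1, Finset.sum_eq_zero]
      · norm_num
      · intro x _
        rw [if_neg]
        intro h2
        rw [h2] at h1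
        simp at h1
  have tot := Finset.sum_congr rfl key
  rw [Finset.sum_comm] at tot
  rw [Finset.sum_const, Finset.card_erase_of_mem (Finset.mem_univ _), Finset.card_univ] at tot
  rw [Nat.card_eq_fintype_card]
  have hpos : 1 ≤ Fintype.card H := Fintype.card_pos
  have : (∑ x : X, ((Nat.card (stabilizer H x) : ℚ) + uniCard H x - 2)) =
      (Fintype.card H - 1) • (2:ℚ) := by
    rw [← tot]
    refine Finset.sum_congr rfl fun x _ => ?_
    rw [Finset.sum_add_distrib]
    have a1 : ∑ h ∈ Finset.univ.erase (1:H), (if h • x = x then (1:ℚ) else 0)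
        = Nat.card (stabilizer H x) - 1 := by
      rw [eq_sub_iff_add_eq]
      have t := Finset.sum_erase_add Finset.univ (fun h : H => if h • x = x then (1:ℚ) else 0)
        (Finset.mem_univ 1)
      simp only [one_smul, if_true] at t
      rw [t, Finset.sum_boole,
        Nat.card_eq_fintype_card, Fintype.card_subtype]
      rfl
    have a2 : ∑ h ∈ Finset.univ.erase (1:H), (if fixedBy X h = {x} then (1:ℚ) else 0)
        = uniCard H x - 1 := by
      rw [Finset.sum_boole, uniCard, Nat.card_eq_fintype_card, Fintype.card_subtype]
      push_cast
      rw [add_sub_cancel_right]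
      congr 2
      ext h; simp
    rw [a1, a2]; ring
  rw [this, nsmul_eq_mul, Nat.cast_sub hpos]
  push_cast; ring

/-- Contribution of an orbit. -/
noncomputable def eVal (H : Type*) {X : Type*} [Group H] [MulAction H X] (x : X) : ℚ :=
  1 + ((uniCard H x : ℚ) - 2) / Nat.card (stabilizer H x)

lemma eVal_smul [Finite H] (g : H) (x : X) : eVal H (g • x) = eVal H x := by
  unfold eVal
  rw [uniCard_smul, card_stab_smul]

lemma orbit_sum [Fintype H] [Fintype X] :
    ∑ x : X, ((Nat.card (stabilizer H x) : ℚ) + uniCard H x - 2) =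
    Nat.card H * ∑ ω : orbitRel.Quotient H X, eVal H (ω.out) := by
  rw [Finset.mul_sum, ← Finset.sum_fiberwise Finset.univ
    (fun x : X => (Quotient.mk'' x : orbitRel.Quotient H X))]
  refine Finset.sum_congr rfl fun ω _ => ?_
  have hval : ∀ x ∈ Finset.univ.filter
      (fun x : X => (Quotient.mk'' x : orbitRel.Quotient H X) = ω),
      ((Nat.card (stabilizer H x) : ℚ) + uniCard H x - 2) =
        eVal H ω.out * Nat.card (stabilizer H ω.out) := by
    intro x hx
    simp only [Finset.mem_filter, Finset.mem_univ, true_and] at hx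
    have : x ∈ orbit H ω.out := by
      rw [← orbitRel_apply, ← Quotient.eq'']
      rw [hx]; exact (Quotient.out_eq' ω).symm
    obtain ⟨g, hg⟩ := this
    simp only at hg
    have hs : (Nat.card (stabilizer H ω.out) : ℚ) ≠ 0 := by
      exact_mod_cast Nat.card_pos.ne'
    rw [← hg, card_stab_smul, uniCard_smul, eVal, add_mul, div_mul_cancel₀ _ hs]
    ring
  rw [Finset.sum_congr rfl hval, Finset.sum_const, nsmul_eq_mul]
  have hc : (Finset.univ.filter
      (fun x : X => (Quotient.mk'' x : orbitRel.Quotient H X) = ω)).card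
      * Nat.card (stabilizer H ω.out) = Nat.card H := by
    rw [Nat.card_eq_fintype_card, Nat.card_eq_fintype_card,
      ← card_orbit_mul_card_stabilizer_eq_card_group H ω.out]
    congr 1
    rw [Fintype.card_subtype]
    congr 1
    ext x
    simp only [Finset.mem_filter, Finset.mem_univ, true_and]
    rw [← orbitRel_apply, ← Quotient.eq'']
    have := Quotient.out_eq' ω
    constructor
    · intro h; rw [h]; exact this.symm
    · intro h; rw [h]; exact this
  rw [← hc]
  push_cast; ring

lemma burnside_eq [Fintype H] [Fintype X]
    (hfix : ∀ h : H, h ≠ 1 → (fixedBy X h).ncard = 1 ∨ (fixedBy X h).ncard = 2) :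
    ∑ ω : orbitRel.Quotient H X, eVal H (ω.out) = 2 - 2 / Nat.card H := by
  have h1 := double_count hfix
  rw [orbit_sum] at h1
  have hs : (Nat.card H : ℚ) ≠ 0 := by exact_mod_cast Nat.card_pos.ne'
  field_simp
  linarith

end Abstract

section Abstract2
open MulAction
open scoped Classical

variable {H X : Type*} [Group H] [MulAction H X]

lemma eVal_cases [Finite H] (x : X) (hd : ∃ c, Nat.card (stabilizer H x) = uniCard H x * c) :
    eVal H x = 0 ∨ eVal H x = 1 / 2 ∨ (2 / 3 ≤ eVal H x ∧ eVal H x < 1) ∨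
      (1 ≤ eVal H x ∧ 2 ≤ uniCard H x) := by
  obtain ⟨c, hc⟩ := hd
  have hs : 0 < Nat.card (stabilizer H x) := Nat.card_pos
  unfold eVal
  rw [hc] at hs ⊢
  have hQ : 0 < uniCard H x := Nat.pos_of_mul_pos_right hs
  have hcp : 0 < c := Nat.pos_of_mul_pos_left hs
  rcases Nat.lt_or_ge (uniCard H x) 2 with h | h
  · have h1 : uniCard H x = 1 := by omega
    rw [h1]
    rcases Nat.lt_or_ge c 3 with h3 | h3
    · interval_cases c
      · left; norm_num
      · right; left; norm_num
    · right; right; left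
      have h3' : (3:ℚ) ≤ c := by exact_mod_cast h3
      have : (1:ℚ) / c ≤ 1 / 3 := by
        apply one_div_le_one_div_of_le <;> linarith
      have h0 : (0:ℚ) < 1 / c := by positivity
      push_cast
      have e : (1 + ((1:ℚ) - 2) / (1 * c)) = 1 - 1 / c := by ring
      rw [e]
      constructor <;> linarith
  · right; right; right
    refine ⟨?_, h⟩
    have h' : (2:ℚ) ≤ uniCard H x := by exact_mod_cast h
    have : 0 ≤ ((uniCard H x : ℚ) - 2) / ((uniCard H x * c : ℕ) : ℚ) :=
      div_nonneg (by linarith) (by positivity)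
    linarith

lemma eVal_nonneg [Finite H] (x : X)
    (hd : ∃ c, Nat.card (stabilizer H x) = uniCard H x * c) : 0 ≤ eVal H x := by
  rcases eVal_cases x hd with h | h | h | h
  · rw [h]
  · rw [h]; norm_num
  · linarith [h.1]
  · linarith [h.1]

lemma three_fixed [Finite X]
    (hfix : ∀ h : H, h ≠ 1 → (fixedBy X h).ncard = 1 ∨ (fixedBy X h).ncard = 2)
    (g : H) (x y z : X) (hxy : x ≠ y) (hxz : x ≠ z) (hyz : y ≠ z) (hx : g • x = x)
    (hy : g • y = y) (hz : g • z = z) : g = 1 := by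
  by_contra hg
  have h3 : ({x, y, z} : Set X).ncard = 3 := Set.ncard_eq_three.mpr ⟨x, y, z, hxy, hxz, hyz, rfl⟩
  have hsub : ({x, y, z} : Set X) ⊆ fixedBy X g := by
    intro w hw
    simp only [Set.mem_insert_iff, Set.mem_singleton_iff] at hw
    rcases hw with rfl | rfl | rfl <;> simpa
  have := Set.ncard_le_ncard hsub (Set.toFinite _)
  rcases hfix g hg with h | h <;> omega

lemma zpowers_fix {A g : H} {x : X} (hx : A • x = x) (hg : g ∈ Subgroup.zpowers A) :
    g • x = x := by
  have : Subgroup.zpowers A ≤ stabilizer H x := by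
    rw [Subgroup.zpowers_le]; exact hx
  exact this hg

lemma free_dvd [Finite H] [Finite X]
    (hfix : ∀ h : H, h ≠ 1 → (fixedBy X h).ncard = 1 ∨ (fixedBy X h).ncard = 2)
    (A : H) (x1 x2 y : X) (h12 : x1 ≠ x2) (hA1 : A • x1 = x1) (hA2 : A • x2 = x2)
    (hy1 : x1 ∉ orbit H y) (hy2 : x2 ∉ orbit H y) :
    orderOf A ∣ Nat.card (orbit H y) := by
  have hst : ∀ b : orbit H y, stabilizer (Subgroup.zpowers A) b = ⊥ := by
    intro b
    rw [eq_bot_iff]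
    rintro ⟨g, hg⟩ hgb
    rw [mem_stabilizer_iff] at hgb
    have hgb' : g • (b : X) = b := congrArg Subtype.val hgb
    have : g = 1 := by
      refine three_fixed hfix g x1 x2 b h12 ?_ ?_ (zpowers_fix hA1 hg) (zpowers_fix hA2 hg) hgb'
      · rintro rfl; exact hy1 b.2
      · rintro rfl; exact hy2 b.2
    subst this
    exact Subgroup.mem_bot.mpr rfl
  rw [Nat.card_congr (selfEquivOrbitsQuotientProd hst), Nat.card_prod, Nat.card_zpowers]
  exact dvd_mul_left _ _

theorem core [Finite H] [Finite X] (n : ℕ) (hn : 6 ≤ n)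
    (hfix : ∀ h : H, h ≠ 1 → (fixedBy X h).ncard = 1 ∨ (fixedBy X h).ncard = 2)
    (hd : ∀ x : X, ∃ c, Nat.card (stabilizer H x) = uniCard H x * c)
    (A : H) (hA : orderOf A = n) (x1 x2 : X) (h12 : x1 ≠ x2)
    (hA1 : A • x1 = x1) (hA2 : A • x2 = x2) (hu1 : uniCard H x1 = 1) (hu2 : uniCard H x2 = 1)
    (hs1 : Nat.card (stabilizer H x1) = n) (hs2 : Nat.card (stabilizer H x2) = n) :
    Nat.card H = n ∨ (Nat.card H = 2 * n ∧ ∃ h : H, h • x1 = x2) ∨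
    ∃ x : X, ∃ s c : ℕ, 3 ≤ uniCard H x ∧ 1 ≤ s ∧ 1 ≤ c ∧
      Nat.card (stabilizer H x) = uniCard H x * c ∧
      s * uniCard H x * n + 2 = s * uniCard H x * c + 2 * s * n := by
  have := Fintype.ofFinite H
  have := Fintype.ofFinite X
  have hB := burnside_eq hfix
  set e : orbitRel.Quotient H X → ℚ := fun ω => eVal H ω.out with he
  change ∑ ω, e ω = _ at hB
  have hnQ : (6:ℚ) ≤ n := by exact_mod_cast hn
  have hinv : (1:ℚ) / n ≤ 1 / 6 := by
    apply one_div_le_one_div_of_le <;> linarith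
  have hinv0 : (0:ℚ) < 1 / n := by positivity
  have hNpos : 0 < Nat.card H := Nat.card_pos
  have hNposQ : (0:ℚ) < Nat.card H := by exact_mod_cast hNpos
  have hout : ∀ x : X, ∃ g : H, (Quotient.mk'' x : orbitRel.Quotient H X).out = g • x := by
    intro x
    have : (Quotient.mk'' x : orbitRel.Quotient H X).out ∈ orbit H x := by
      rw [← orbitRel_apply, ← Quotient.eq'']
      exact Quotient.out_eq' _
    obtain ⟨g, hg⟩ := this
    exact ⟨g, hg.symm⟩
  have hemk : ∀ x : X, e (Quotient.mk'' x) = eVal H x := by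
    intro x
    obtain ⟨g, hg⟩ := hout x
    simp only [he, hg, eVal_smul]
  have he1 : e (Quotient.mk'' x1) = 1 - 1 / n := by
    rw [hemk, eVal, hu1, hs1]; push_cast; ring
  have he2 : e (Quotient.mk'' x2) = 1 - 1 / n := by
    rw [hemk, eVal, hu2, hs2]; push_cast; ring
  have hnn : ∀ ω, 0 ≤ e ω := fun ω => eVal_nonneg _ (hd _)
  have hdvd : n ∣ Nat.card H := hA ▸ orderOf_dvd_natCard A
  by_cases hNn : Nat.card H = n
  · exact Or.inl hNn
  right
  have hN2 : 2 * n ≤ Nat.card H := by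
    obtain ⟨k, hk⟩ := hdvd
    have : k ≠ 0 := by rintro rfl; omega
    have : k ≠ 1 := by rintro rfl; omega
    have : 2 ≤ k := by omega
    rw [hk]; nlinarith
  have hN2Q : (2:ℚ) * n ≤ Nat.card H := by exact_mod_cast hN2
  have h2N : (2:ℚ) / Nat.card H ≤ 1 / n := by
    rw [div_le_div_iff₀ hNposQ (by linarith)]; linarith
  have h2N0 : (0:ℚ) < 2 / Nat.card H := by positivity
  by_cases hω : (Quotient.mk'' x1 : orbitRel.Quotient H X) = Quotient.mk'' x2
  swap
  · exfalso
    rw [← Finset.add_sum_erase _ _ (Finset.mem_univ (Quotient.mk'' x1)),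
      ← Finset.add_sum_erase _ _ (Finset.mem_erase.mpr ⟨Ne.symm hω, Finset.mem_univ _⟩),
      he1, he2] at hB
    set R := ((Finset.univ.erase (Quotient.mk'' x1 : orbitRel.Quotient H X)).erase
      (Quotient.mk'' x2)) with hR
    have hz : ∑ ω ∈ R, e ω = 0 := by
      apply Finset.sum_eq_zero
      intro ω hωR
      have hle : e ω ≤ ∑ ω ∈ R, e ω := Finset.single_le_sum (fun ω _ => hnn ω) hωR
      rcases eVal_cases ω.out (hd _) with h | h | h | h
      · exact h
      · have : e ω = 1 / 2 := h
        linarith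
      · have : 2 / 3 ≤ e ω := h.1
        linarith
      · have : 1 ≤ e ω := h.1
        linarith
    rw [hz] at hB
    linarith
  have hswap : ∃ h : H, h • x1 = x2 := by
    have := Quotient.eq''.mp hω.symm
    rw [orbitRel_apply] at this
    exact this
  rw [← Finset.add_sum_erase _ _ (Finset.mem_univ (Quotient.mk'' x1)), he1] at hB
  set R := (Finset.univ.erase (Quotient.mk'' x1 : orbitRel.Quotient H X)) with hR
  have hsum : ∑ ω ∈ R, e ω = 1 + 1 / n - 2 / Nat.card H := by linarith
  have hfin : (2:ℚ) / Nat.card H = 1 / n → Nat.card H = 2 * n := by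
    intro h
    have h3 : (2:ℚ) * n = Nat.card H := by
      field_simp at h; linarith
    exact_mod_cast h3.symm
  by_cases hp : ∃ ω ∈ R, 2 ≤ uniCard H ω.out
  · obtain ⟨ω, hωR, hQ⟩ := hp
    have heω : 1 ≤ e ω := by
      obtain ⟨c, hc⟩ := hd ω.out
      have h' : (2:ℚ) ≤ uniCard H ω.out := by exact_mod_cast hQ
      have : 0 ≤ ((uniCard H ω.out : ℚ) - 2) / (Nat.card (stabilizer H ω.out) : ℚ) :=
        div_nonneg (by linarith) (by positivity)
      simp only [he, eVal]; linarith
    rw [← Finset.add_sum_erase _ _ hωR] at hsum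
    have hz : ∑ ω ∈ R.erase ω, e ω = 0 := by
      apply Finset.sum_eq_zero
      intro ω' hωR'
      have hle : e ω' ≤ ∑ ω ∈ R.erase ω, e ω := Finset.single_le_sum (fun ω _ => hnn ω) hωR'
      rcases eVal_cases ω'.out (hd _) with h | h | h | h
      · exact h
      · have : e ω' = 1 / 2 := h
        linarith
      · have : 2 / 3 ≤ e ω' := h.1
        linarith
      · have : 1 ≤ e ω' := h.1
        linarith
    rw [hz, add_zero] at hsum
    rcases Nat.lt_or_ge (uniCard H ω.out) 3 with h3 | h3
    · left
      refine ⟨hfin ?_, hswap⟩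
      have h2 : uniCard H ω.out = 2 := by omega
      simp only [he, eVal, h2] at hsum
      norm_num at hsum
      norm_num
      linarith
    · right
      obtain ⟨c, hc⟩ := hd ω.out
      have hcpos : 0 < c := by
        have : 0 < Nat.card (stabilizer H ω.out) := Nat.card_pos
        rw [hc] at this
        exact Nat.pos_of_mul_pos_left this
      have hno : ∀ x : X, (Quotient.mk'' x : orbitRel.Quotient H X) = Quotient.mk'' x1 →
          x ∉ orbit H ω.out := by
        intro x hx hmem
        rw [← orbitRel_apply, ← Quotient.eq'', hx] at hmem
        have h5 : (Quotient.mk'' ω.out : orbitRel.Quotient H X) = ω := Quotient.out_eq' ω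
        rw [h5] at hmem
        rw [hR, Finset.mem_erase] at hωR
        exact hωR.1 hmem.symm
      have hfree := free_dvd hfix A x1 x2 ω.out h12 hA1 hA2 (hno _ rfl) (hno _ hω.symm)
      rw [hA] at hfree
      obtain ⟨s, hs⟩ := hfree
      have hos : Nat.card (orbit H ω.out) * Nat.card (stabilizer H ω.out) = Nat.card H := by
        rw [Nat.card_eq_fintype_card, Nat.card_eq_fintype_card, Nat.card_eq_fintype_card]
        exact card_orbit_mul_card_stabilizer_eq_card_group H ω.out
      rw [hs, hc] at hos
      have hspos : 0 < s := by
        rcases Nat.eq_zero_or_pos s with h | h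
        · rw [h, Nat.mul_zero, Nat.zero_mul] at hos; omega
        · exact h
      refine ⟨ω.out, s, c, h3, hspos, hcpos, hc, ?_⟩
      simp only [he, eVal, hc] at hsum
      rw [← hos] at hsum
      have hQp : (0:ℚ) < uniCard H ω.out := by
        exact_mod_cast (by omega : 0 < uniCard H ω.out)
      have hsp : (0:ℚ) < s := by exact_mod_cast hspos
      have hcp : (0:ℚ) < c := by exact_mod_cast hcpos
      have hnp : (0:ℚ) < n := by linarith
      push_cast at hsum
      have : (s * uniCard H ω.out * n + 2 : ℚ) = s * uniCard H ω.out * c + 2 * s * n := by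
        generalize (uniCard H ω.out : ℚ) = Q at *
        have h6 : (Q - 2) / (Q * c) = 1 / n - 2 / (n * s * (Q * c)) := by linarith
        field_simp at h6
        linarith
      exact_mod_cast this
  · left
    refine ⟨hfin ?_, hswap⟩
    push Not at hp
    have hcase : ∀ ω ∈ R, e ω = 0 ∨ e ω = 1 / 2 ∨ (2 / 3 ≤ e ω ∧ e ω < 1) := by
      intro ω hωR
      rcases eVal_cases ω.out (hd _) with h | h | h | h
      · exact Or.inl h
      · exact Or.inr (Or.inl h)
      · exact Or.inr (Or.inr h)
      · have := hp ω hωR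
        omega
    have hex : ∃ ω ∈ R, e ω ≠ 0 := by
      by_contra hcon
      push Not at hcon
      rw [Finset.sum_eq_zero hcon] at hsum
      linarith
    obtain ⟨ω, hωR, hne⟩ := hex
    rw [← Finset.add_sum_erase _ _ hωR] at hsum
    have hex2 : ∃ ω' ∈ R.erase ω, e ω' ≠ 0 := by
      by_contra hcon
      push Not at hcon
      rw [Finset.sum_eq_zero hcon] at hsum
      rcases hcase ω hωR with h | h | h
      · exact hne h
      · linarith
      · linarith [h.2]
    obtain ⟨ω', hωR', hne'⟩ := hex2
    rw [← Finset.add_sum_erase _ _ hωR'] at hsum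
    have hpos : 0 ≤ ∑ ω ∈ (R.erase ω).erase ω', e ω := Finset.sum_nonneg fun ω _ => hnn ω
    rcases hcase ω hωR with h | h | h
    · exact absurd h hne
    · rcases hcase ω' (Finset.mem_of_mem_erase hωR') with h' | h' | h'
      · exact absurd h' hne'
      · have hz : ∑ ω ∈ (R.erase ω).erase ω', e ω = 0 := by
          apply Finset.sum_eq_zero
          intro ω₃ hω₃
          have hle : e ω₃ ≤ ∑ ω ∈ (R.erase ω).erase ω', e ω :=
            Finset.single_le_sum (fun ω _ => hnn ω) hω₃
          rcases hcase ω₃ (Finset.mem_of_mem_erase (Finset.mem_of_mem_erase hω₃)) with k | k | k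
          · exact k
          · linarith
          · linarith [k.1]
        linarith
      · linarith [h'.1]
    · rcases hcase ω' (Finset.mem_of_mem_erase hωR') with h' | h' | h'
      · exact absurd h' hne'
      · linarith [h.1]
      · linarith [h'.1, h.1]

end Abstract2

section Abstract3
open MulAction
open scoped Classical

variable {H X : Type*} [Group H] [MulAction H X]

lemma dihedral_of [Finite H] (n : ℕ) (hn : 1 ≤ n) (A h : H) (hA : orderOf A = n)
    (hcard : Nat.card H = 2 * n) (hh : h ∉ Subgroup.zpowers A) (h2 : h * h = 1)
    (hA2 : (h * A) * (h * A) = 1) : Nonempty (H ≃* DihedralGroup n) := by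
  have : NeZero n := ⟨by omega⟩
  have hrel : h * A * h = A⁻¹ := by
    rw [eq_inv_iff_mul_eq_one, mul_assoc (h * A)]; exact hA2
  have hhinv : h⁻¹ = h := inv_eq_of_mul_eq_one_left h2
  have hpow : ∀ i : ℤ, A ^ i * h = h * A ^ (-i) := by
    intro i
    have : h * A ^ i * h⁻¹ = A ^ (-i) := by
      rw [← conj_zpow, hhinv, hrel, _root_.inv_zpow, _root_.zpow_neg]
    rw [← this, hhinv]
    simp only [← mul_assoc]; rw [h2, one_mul]
  let a : ZMod n → H := fun i => A ^ (i.cast : ℤ)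
  have ha : ∀ i : ℤ, a (i : ZMod n) = A ^ i := by
    intro i
    simp only [a]
    rw [zpow_eq_zpow_iff_modEq, hA, ← ZMod.intCast_eq_intCast_iff]
    simp
  have ha_add : ∀ i j : ZMod n, a (i + j) = a i * a j := by
    intro i j
    obtain ⟨i, rfl⟩ := ZMod.intCast_surjective i
    obtain ⟨j, rfl⟩ := ZMod.intCast_surjective j
    rw [← Int.cast_add, ha, ha, ha, _root_.zpow_add]
  have ha_h : ∀ i : ZMod n, a i * h = h * a (-i) := by
    intro i
    obtain ⟨i, rfl⟩ := ZMod.intCast_surjective i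
    rw [← Int.cast_neg, ha, ha, hpow]
  have ha_inj : Function.Injective a := by
    intro i j hij
    obtain ⟨i, rfl⟩ := ZMod.intCast_surjective i
    obtain ⟨j, rfl⟩ := ZMod.intCast_surjective j
    rw [ha, ha, zpow_eq_zpow_iff_modEq, hA] at hij
    exact (ZMod.intCast_eq_intCast_iff _ _ _).mpr hij
  have ha_mem : ∀ i, a i ∈ Subgroup.zpowers A := fun i => ⟨_, rfl⟩
  have ha0 : a 0 = 1 := by
    have := ha 0
    simpa using this
  let f : DihedralGroup n →* H :=
    { toFun := fun x => match x with
        | .r i => a i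
        | .sr i => h * a i
      map_one' := ha0
      map_mul' := by
        rintro (i | i) (j | j)
        · simp only [DihedralGroup.r_mul_r, ha_add]
        · simp only [DihedralGroup.r_mul_sr]
          rw [← mul_assoc, ha_h, mul_assoc, ← ha_add]
          congr 2; ring
        · simp only [DihedralGroup.sr_mul_r, ha_add, mul_assoc]
        · simp only [DihedralGroup.sr_mul_sr]
          rw [mul_assoc, ← mul_assoc (a i), ha_h, ← mul_assoc, ← mul_assoc, h2, one_mul, ← ha_add]
          congr 1; ring }
  have hinj : Function.Injective f := by
    rintro (i | i) (j | j) hij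
    · exact congrArg _ (ha_inj hij)
    · exfalso
      apply hh
      have : h = a i * (a j)⁻¹ := by
        rw [eq_mul_inv_iff_mul_eq]; exact hij.symm
      rw [this]
      exact mul_mem (ha_mem _) (inv_mem (ha_mem _))
    · exfalso
      apply hh
      have : h = a j * (a i)⁻¹ := by
        rw [eq_mul_inv_iff_mul_eq]; exact hij
      rw [this]
      exact mul_mem (ha_mem _) (inv_mem (ha_mem _))
    · have hij' : h * a i = h * a j := hij
      exact congrArg _ (ha_inj (mul_left_cancel hij'))
  have hbij : Function.Bijective f := by
    have := Fintype.ofFinite H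
    rw [Fintype.bijective_iff_injective_and_card]
    refine ⟨hinj, ?_⟩
    rw [← Nat.card_eq_fintype_card, ← Nat.card_eq_fintype_card, DihedralGroup.nat_card, hcard]
  exact ⟨(MulEquiv.ofBijective f hbij).symm⟩

lemma swap_dihedral [Finite H] [Finite X] (n : ℕ) (hn : 1 ≤ n)
    (A h : H) (hA : orderOf A = n) (hcard : Nat.card H = 2 * n)
    (x1 x2 : X) (h12 : x1 ≠ x2)
    (hA1 : A • x1 = x1) (hA2 : A • x2 = x2)
    (hfixA : ∀ y : X, A • y = y → y = x1 ∨ y = x2)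
    (hs1 : Nat.card (stabilizer H x1) = n) (hs2 : Nat.card (stabilizer H x2) = n)
    (hinvol : ∀ g : H, g • x1 = x2 → g • x2 = x1 → g * g = 1)
    (hh : h • x1 = x2) : Nonempty (H ≃* DihedralGroup n) := by
  have e2 : Subgroup.zpowers A = stabilizer H x2 := by
    apply Subgroup.eq_of_le_of_card_ge
    · rw [Subgroup.zpowers_le]; exact hA2
    · rw [hs2, Nat.card_zpowers, hA]
  have e1 : Subgroup.zpowers A = stabilizer H x1 := by
    apply Subgroup.eq_of_le_of_card_ge
    · rw [Subgroup.zpowers_le]; exact hA1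
    · rw [hs1, Nat.card_zpowers, hA]
  have hswap : h • x2 = x1 := by
    have hm : h⁻¹ * A * h ∈ stabilizer H x1 := by
      rw [mem_stabilizer_iff, mul_smul, hh, mul_smul, hA2, ← hh, inv_smul_smul]
    rw [← e1] at hm
    have hm2 := zpowers_fix hA2 hm
    rw [mul_smul, mul_smul, inv_smul_eq_iff] at hm2
    rcases hfixA _ hm2 with h' | h'
    · exact h'
    · exfalso
      exact h12 (smul_left_cancel h (hh.trans h'.symm))
  apply dihedral_of n hn A h hA hcard
  · intro hm
    rw [e1, mem_stabilizer_iff, hh] at hm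
    exact h12 hm.symm
  · exact hinvol h hh hswap
  · apply hinvol
    · rw [mul_smul, hA1, hh]
    · rw [mul_smul, hA2, hswap]

lemma uni_dvd [Finite H] [Finite X]
    (hfix : ∀ h : H, h ≠ 1 → (fixedBy X h).ncard = 1 ∨ (fixedBy X h).ncard = 2)
    (A : H) (x1 x2 : X) (h12 : x1 ≠ x2) (hA1 : A • x1 = x1) (hA2 : A • x2 = x2) :
    orderOf A ∣ uniCard H x1 - 1 := by
  have hpres : ∀ g : Subgroup.zpowers A, ∀ u : {h : H // h ≠ 1 ∧ fixedBy X h = {x1}},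
      (g : H) * u * (g : H)⁻¹ ≠ 1 ∧ fixedBy X ((g : H) * u * (g : H)⁻¹) = {x1} := by
    intro g u
    refine ⟨by simpa using u.2.1, ?_⟩
    have := (fixedBy_conj_eq (g : H) (u : H) x1).mpr u.2.2
    rw [zpowers_fix hA1 g.2] at this
    exact this
  let act : MulAction (Subgroup.zpowers A) {h : H // h ≠ 1 ∧ fixedBy X h = {x1}} :=
    { smul := fun g u => ⟨(g : H) * u * (g : H)⁻¹, hpres g u⟩
      one_smul := by
        intro u; apply Subtype.ext
        change (1 : H) * u * (1 : H)⁻¹ = u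
        simp
      mul_smul := by
        intro a b u; apply Subtype.ext
        change ((a : H) * b) * u * ((a : H) * b)⁻¹ = a * (b * u * (b : H)⁻¹) * (a : H)⁻¹
        group }
  have hst : ∀ b : {h : H // h ≠ 1 ∧ fixedBy X h = {x1}},
      stabilizer (Subgroup.zpowers A) b = ⊥ := by
    intro u
    rw [eq_bot_iff]
    rintro ⟨g, hg⟩ hgb
    rw [mem_stabilizer_iff] at hgb
    have hgb' : g * u * g⁻¹ = u := congrArg Subtype.val hgb
    have hg1 : g = 1 := by
      have hux2 : (u : H) • x2 ≠ x2 := by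
        intro hc
        have : x2 ∈ fixedBy X (u : H) := hc
        rw [u.2.2] at this
        exact h12 this.symm
      have hux1 : (u : H) • x1 = x1 := by
        have : x1 ∈ fixedBy X (u : H) := by rw [u.2.2]; rfl
        exact this
      refine three_fixed hfix g x1 x2 ((u : H) • x2) h12 ?_ hux2.symm (zpowers_fix hA1 hg)
        (zpowers_fix hA2 hg) ?_
      · intro hc
        apply h12
        apply smul_left_cancel (u : H)
        rw [hux1]; exact hc
      · rw [← mul_smul, mul_inv_eq_iff_eq_mul.mp hgb', mul_smul, zpowers_fix hA2 hg]
    subst hg1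
    exact Subgroup.mem_bot.mpr rfl
  unfold uniCard
  rw [Nat.add_sub_cancel, Nat.card_congr (selfEquivOrbitsQuotientProd hst), Nat.card_prod,
    Nat.card_zpowers]
  exact dvd_mul_left _ _

end Abstract3

section Line
open MulAction
open scoped LinearAlgebra.Projectivization

/-- The projective line over `L`, on which `PSL₂(F)` acts. -/
def PLine (F L : Type) [Field F] [Field L] [Algebra F L] : Type := ℙ L (Fin 2 → L)

variable {F L : Type} [Field F] [Field L] [Algebra F L]

instance [Finite L] : Finite (PLine F L) := by
  unfold PLine Projectivization
  infer_instance

/-- The linear action over `L`. -/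
def lact (L : Type) [Field L] [Algebra F L] (g : SpecialLinearGroup (Fin 2) F) (v : Fin 2 → L) :
    Fin 2 → L :=
  ![algebraMap F L (g 0 0) * v 0 + algebraMap F L (g 0 1) * v 1,
    algebraMap F L (g 1 0) * v 0 + algebraMap F L (g 1 1) * v 1]

lemma lact_eq (g : SpecialLinearGroup (Fin 2) F) (v : Fin 2 → L) :
    (SpecialLinearGroup.map (algebraMap F L) g) • v = lact L g v := by
  rw [Matrix.SpecialLinearGroup.smul_def]
  ext i
  fin_cases i <;> simp [lact, Matrix.mulVec, dotProduct, Fin.sum_univ_two]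

lemma det_eq (g : SpecialLinearGroup (Fin 2) F) : g 0 0 * g 1 1 - g 0 1 * g 1 0 = 1 := by
  have := g.det_coe
  rwa [Matrix.det_fin_two] at this

lemma det_eqL (L : Type) [Field L] [Algebra F L] (g : SpecialLinearGroup (Fin 2) F) :
    algebraMap F L (g 0 0) * algebraMap F L (g 1 1) -
      algebraMap F L (g 0 1) * algebraMap F L (g 1 0) = 1 := by
  have := congrArg (algebraMap F L) (det_eq g)
  simpa using this

lemma center_iff (g : SpecialLinearGroup (Fin 2) F) :
    g ∈ Subgroup.center (SpecialLinearGroup (Fin 2) F) ↔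
      g 0 1 = 0 ∧ g 1 0 = 0 ∧ g 0 0 = g 1 1 := by
  rw [Matrix.SpecialLinearGroup.mem_center_iff]
  constructor
  · rintro ⟨r, _, hr⟩
    rw [← hr]
    simp
  · rintro ⟨h1, h2, h3⟩
    refine ⟨g 0 0, ?_, ?_⟩
    · have := det_eq g
      rw [h1, ← h3] at this
      rw [Fintype.card_fin]
      linear_combination this
    · ext i j
      fin_cases i <;> fin_cases j <;> simp [h1, h2, h3]

/-- The permutation representation of `SL₂(F)`. -/
def slPerm (F L : Type) [Field F] [Field L] [Algebra F L] :
    SpecialLinearGroup (Fin 2) F →* Equiv.Perm (PLine F L) :=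
  (MulAction.toPermHom (SpecialLinearGroup (Fin 2) L) (ℙ L (Fin 2 → L))).comp
    (SpecialLinearGroup.map (algebraMap F L))

/-- The point with homogeneous coordinates `v`. -/
def pt (F : Type) {L : Type} [Field F] [Field L] [Algebra F L] (v : Fin 2 → L) (hv : v ≠ 0) :
    PLine F L := Projectivization.mk L v hv

lemma exists_pt (x : PLine F L) : ∃ (v : Fin 2 → L) (hv : v ≠ 0), x = pt F v hv :=
  ⟨Projectivization.rep x, Projectivization.rep_nonzero x, (Projectivization.mk_rep x).symm⟩

/-- Cross product. -/
def crs (v w : Fin 2 → L) : L := v 0 * w 1 - v 1 * w 0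

lemma vec_ne_zero {R : Type} [Field R] {v : Fin 2 → R} (hv : v ≠ 0) : v 0 ≠ 0 ∨ v 1 ≠ 0 := by
  by_contra h
  push Not at h
  apply hv
  ext i; fin_cases i
  · exact h.1
  · exact h.2

lemma pt_eq_iff (v w : Fin 2 → L) (hv : v ≠ 0) (hw : w ≠ 0) :
    pt F v hv = pt F w hw ↔ ∃ c : L, v = c • w := by
  refine (Projectivization.mk_eq_mk_iff' L v w hv hw).trans ?_
  constructor
  · rintro ⟨a, ha⟩; exact ⟨a, ha.symm⟩
  · rintro ⟨a, ha⟩; exact ⟨a, ha.symm⟩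

lemma pt_eq_iff_crs (v w : Fin 2 → L) (hv : v ≠ 0) (hw : w ≠ 0) :
    pt F v hv = pt F w hw ↔ crs v w = 0 := by
  rw [pt_eq_iff]
  unfold crs
  constructor
  · rintro ⟨c, rfl⟩
    simp; ring
  · intro h
    rcases vec_ne_zero hw with h0 | h0
    · refine ⟨v 0 / w 0, ?_⟩
      ext i; fin_cases i
      · simp; field_simp
      · simp; field_simp; linear_combination -h
    · refine ⟨v 1 / w 1, ?_⟩
      ext i; fin_cases i
      · simp; field_simp; linear_combination h
      · simp; field_simp

lemma slPerm_pt (g : SpecialLinearGroup (Fin 2) F) (v w : Fin 2 → L) (hv : v ≠ 0) (hw : w ≠ 0) :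
    slPerm F L g (pt F v hv) = pt F w hw ↔ ∃ c : L, lact L g v = c • w := by
  have hne : lact L g v ≠ 0 := by
    rw [← lact_eq]
    exact (smul_ne_zero_iff_ne _).mpr hv
  have : slPerm F L g (pt F v hv) = pt F (lact L g v) hne := by
    change (SpecialLinearGroup.map (algebraMap F L) g) • Projectivization.mk L v hv = _
    rw [Projectivization.smul_mk]
    unfold pt
    congr 1
    exact lact_eq g v
  rw [this, pt_eq_iff]

lemma slPerm_center (g : SpecialLinearGroup (Fin 2) F)
    (hg : g ∈ Subgroup.center (SpecialLinearGroup (Fin 2) F)) : slPerm F L g = 1 := by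
  ext x
  obtain ⟨v, hv, rfl⟩ := exists_pt x
  rw [Equiv.Perm.one_apply, slPerm_pt]
  obtain ⟨h1, h2, h3⟩ := (center_iff g).mp hg
  refine ⟨algebraMap F L (g 0 0), ?_⟩
  ext i; fin_cases i <;> simp [lact, h1, h2, h3]

/-- The permutation representation of `PSL₂(F)`. -/
def pslPerm (F L : Type) [Field F] [Field L] [Algebra F L] :
    ProjectiveSpecialLinearGroup (Fin 2) F →* Equiv.Perm (PLine F L) :=
  QuotientGroup.lift _ (slPerm F L) (fun g hg => slPerm_center g hg)

instance : MulAction (ProjectiveSpecialLinearGroup (Fin 2) F) (PLine F L) :=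
  MulAction.compHom _ (pslPerm F L)

/-- projection. -/
abbrev toPSL (g : SpecialLinearGroup (Fin 2) F) : ProjectiveSpecialLinearGroup (Fin 2) F :=
  QuotientGroup.mk' (Subgroup.center (SpecialLinearGroup (Fin 2) F)) g

lemma smul_pt_iff (g : SpecialLinearGroup (Fin 2) F) (v w : Fin 2 → L) (hv : v ≠ 0) (hw : w ≠ 0) :
    toPSL g • pt F v hv = pt F w hw ↔ ∃ c : L, lact L g v = c • w := by
  rw [← slPerm_pt]
  rfl

lemma toPSL_eq_one (g : SpecialLinearGroup (Fin 2) F) :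
    toPSL g = 1 ↔ g 0 1 = 0 ∧ g 1 0 = 0 ∧ g 0 0 = g 1 1 := by
  rw [← center_iff]
  exact QuotientGroup.eq_one_iff g

lemma toPSL_surj (h : ProjectiveSpecialLinearGroup (Fin 2) F) : ∃ g, toPSL g = h :=
  QuotientGroup.mk'_surjective _ h

lemma lact_mul (g h : SpecialLinearGroup (Fin 2) F) (v : Fin 2 → L) :
    lact L (g * h) v = lact L g (lact L h v) := by
  rw [← lact_eq, map_mul, mul_smul, lact_eq, lact_eq]

lemma lact_smul (g : SpecialLinearGroup (Fin 2) F) (c : L) (v : Fin 2 → L) :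
    lact L g (c • v) = c • lact L g v := by
  ext i; fin_cases i <;> simp [lact] <;> ring

lemma crs_lact (g : SpecialLinearGroup (Fin 2) F) (v w : Fin 2 → L) :
    crs (lact L g v) (lact L g w) = crs v w := by
  have := det_eqL L g
  simp only [crs, lact, Matrix.cons_val_zero, Matrix.cons_val_one]
  linear_combination (v 0 * w 1 - v 1 * w 0) * this

/-- equal eigenvalues on independent vectors: scalar. -/
lemma scalar_of (g : SpecialLinearGroup (Fin 2) F) (v w : Fin 2 → L) (l : L)
    (hv : lact L g v = l • v) (hw : lact L g w = l • w) (hvw : crs v w ≠ 0) : toPSL g = 1 := by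
  rw [toPSL_eq_one]
  have v0 := congrFun hv 0
  have v1 := congrFun hv 1
  have w0 := congrFun hw 0
  have w1 := congrFun hw 1
  simp only [lact, Matrix.cons_val_zero, Matrix.cons_val_one, Pi.smul_apply, smul_eq_mul]
    at v0 v1 w0 w1
  have inj := (algebraMap F L).injective
  have a1 : algebraMap F L (g 0 1) = 0 := by
    apply mul_left_cancel₀ hvw
    unfold crs
    linear_combination v 0 * w0 - w 0 * v0
  have a2 : algebraMap F L (g 1 0) = 0 := by
    apply mul_left_cancel₀ hvw
    unfold crs
    linear_combination w 1 * v1 - v 1 * w1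
  have a3 : algebraMap F L (g 0 0) = l := by
    apply mul_left_cancel₀ hvw
    unfold crs
    linear_combination w 1 * v0 - v 1 * w0
  have a4 : algebraMap F L (g 1 1) = l := by
    apply mul_left_cancel₀ hvw
    unfold crs
    linear_combination v 0 * w1 - w 0 * v1
  refine ⟨inj (by simpa using a1), inj (by simpa using a2), inj (a3.trans a4.symm)⟩

/-- product of eigenvalues. -/
lemma eig_mul (g : SpecialLinearGroup (Fin 2) F) (v w : Fin 2 → L) (l m : L)
    (hv : lact L g v = l • v) (hw : lact L g w = m • w) (hvw : crs v w ≠ 0) : l * m = 1 := by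
  have := crs_lact g v w
  rw [hv, hw] at this
  apply mul_left_cancel₀ hvw
  simp only [crs, Pi.smul_apply, smul_eq_mul] at this ⊢
  linear_combination this

lemma eig_root (g : SpecialLinearGroup (Fin 2) F) (v : Fin 2 → L) (hv0 : v ≠ 0) (l : L)
    (hv : lact L g v = l • v) : l ^ 2 - algebraMap F L (g 0 0 + g 1 1) * l + 1 = 0 := by
  have v0 := congrFun hv 0
  have v1 := congrFun hv 1
  simp only [lact, Matrix.cons_val_zero, Matrix.cons_val_one, Pi.smul_apply, smul_eq_mul]
    at v0 v1
  have d := det_eqL L g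
  rw [map_add]
  rcases vec_ne_zero hv0 with h | h
  · apply mul_left_cancel₀ h
    linear_combination (-v 0) * d + (algebraMap F L (g 1 1) - l) * v0 - algebraMap F L (g 0 1) * v1
  · apply mul_left_cancel₀ h
    linear_combination (-v 1) * d + (algebraMap F L (g 0 0) - l) * v1 - algebraMap F L (g 1 0) * v0

/-- eigenvectors exist for roots. -/
lemma exists_eig (g : SpecialLinearGroup (Fin 2) F) (l : L)
    (hl : l ^ 2 - algebraMap F L (g 0 0 + g 1 1) * l + 1 = 0) :
    ∃ v : Fin 2 → L, v ≠ 0 ∧ lact L g v = l • v := by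
  have d := det_eqL L g
  rw [map_add] at hl
  by_cases h1 : algebraMap F L (g 0 1) = 0 ∧ l - algebraMap F L (g 0 0) = 0
  · by_cases h2 : l - algebraMap F L (g 1 1) = 0
    · refine ⟨![0, 1], ?_, ?_⟩
      · intro h; simpa using congrFun h 1
      · ext i; fin_cases i
        · simp [lact, h1.1]
        · simp [lact]; linear_combination -h2
    · refine ⟨![l - algebraMap F L (g 1 1), algebraMap F L (g 1 0)], ?_, ?_⟩
      · intro h; exact h2 (by simpa using congrFun h 0)
      · ext i; fin_cases i
        · simp [lact]; linear_combination -hl - d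
        · simp [lact]; ring
  · refine ⟨![algebraMap F L (g 0 1), l - algebraMap F L (g 0 0)], ?_, ?_⟩
    · intro h
      exact h1 ⟨by simpa using congrFun h 0, by simpa using congrFun h 1⟩
    · ext i; fin_cases i
      · simp [lact]; ring
      · simp [lact]; linear_combination -hl - d

lemma root_ne_zero {t l : L} (hl : l ^ 2 - t * l + 1 = 0) : l ≠ 0 := by
  rintro rfl; simp at hl

lemma fix_ncard [Finite L] (hroot : ∀ t : F, ∃ l : L, l ^ 2 - algebraMap F L t * l + 1 = 0)
    (h : ProjectiveSpecialLinearGroup (Fin 2) F) (hh : h ≠ 1) :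
    (fixedBy (PLine F L) h).ncard = 1 ∨ (fixedBy (PLine F L) h).ncard = 2 := by
  obtain ⟨g, rfl⟩ := toPSL_surj h
  have hpos : 0 < (fixedBy (PLine F L) (toPSL g)).ncard := by
    rw [Set.ncard_pos (Set.toFinite _)]
    obtain ⟨l, hl⟩ := hroot (g 0 0 + g 1 1)
    obtain ⟨v, hv, hev⟩ := exists_eig g l hl
    exact ⟨pt F v hv, (smul_pt_iff g v v hv hv).mpr ⟨l, hev⟩⟩
  have hle : ¬ 2 < (fixedBy (PLine F L) (toPSL g)).ncard := by
    rw [Set.two_lt_ncard]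
    rintro ⟨x, hx, y, hy, z, hz, hxy, hxz, hyz⟩
    obtain ⟨u, hu, rfl⟩ := exists_pt x
    obtain ⟨v, hv, rfl⟩ := exists_pt y
    obtain ⟨w, hw, rfl⟩ := exists_pt z
    rw [mem_fixedBy, smul_pt_iff] at hx hy hz
    obtain ⟨a, ha⟩ := hx
    obtain ⟨b, hb⟩ := hy
    obtain ⟨c, hc⟩ := hz
    rw [Ne, pt_eq_iff_crs] at hxy hxz hyz
    have e1 := eig_mul g u v a b ha hb hxy
    have e2 := eig_mul g u w a c ha hc hxz
    have e3 := eig_mul g v w b c hb hc hyz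
    have hbc : b = c := mul_left_cancel₀ (left_ne_zero_of_mul_eq_one e1) (e1.trans e2.symm)
    subst hbc
    exact hh (scalar_of g v w b hb hc hyz)
  omega

lemma swap_sq (h : ProjectiveSpecialLinearGroup (Fin 2) F) (x y : PLine F L) (hxy : x ≠ y)
    (h1 : h • x = y) (h2 : h • y = x) : h * h = 1 := by
  obtain ⟨g, rfl⟩ := toPSL_surj h
  obtain ⟨u, hu, rfl⟩ := exists_pt x
  obtain ⟨v, hv, rfl⟩ := exists_pt y
  rw [smul_pt_iff] at h1 h2
  rw [Ne, pt_eq_iff_crs] at hxy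
  obtain ⟨a, ha⟩ := h1
  obtain ⟨b, hb⟩ := h2
  have : toPSL g * toPSL g = toPSL (g * g) := rfl
  rw [this]
  refine scalar_of (g * g) u v (a * b) ?_ ?_ hxy
  · rw [lact_mul, ha, lact_smul, hb, smul_smul]
  · rw [lact_mul, hb, lact_smul, ha, smul_smul, mul_comm]

end Line

section Stab
open MulAction

variable {F L : Type} [Field F] [Field L] [Algebra F L]

lemma eig_unique (g : SpecialLinearGroup (Fin 2) F) (v : Fin 2 → L) (hv : v ≠ 0) (l m : L)
    (h1 : lact L g v = l • v) (h2 : lact L g v = m • v) : l = m := by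
  rw [h1] at h2
  exact smul_left_injective L hv h2

lemma lift_sq (g g' : SpecialLinearGroup (Fin 2) F) (hgg : toPSL g = toPSL g')
    (v : Fin 2 → L) (hv : v ≠ 0) (l l' : L)
    (h1 : lact L g v = l • v) (h2 : lact L g' v = l' • v) : l ^ 2 = l' ^ 2 := by
  have hz : toPSL (g⁻¹ * g') = 1 := by
    have : toPSL (g⁻¹ * g') = (toPSL g)⁻¹ * toPSL g' := rfl
    rw [this, hgg, inv_mul_cancel]
  set z := g⁻¹ * g' with hzdef
  have hg' : g' = g * z := by rw [hzdef, mul_inv_cancel_left]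
  rw [toPSL_eq_one] at hz
  obtain ⟨z1, z2, z3⟩ := hz
  have hzv : lact L z v = algebraMap F L (z 0 0) • v := by
    ext i; fin_cases i <;> simp [lact, z1, z2, z3]
  have hd := det_eqL L z
  rw [← z3, z1] at hd
  rw [hg', lact_mul, hzv, lact_smul, h1, smul_smul] at h2
  have := smul_left_injective L hv h2
  simp only [map_zero] at hd
  rw [← this, mul_pow]
  linear_combination (-l ^ 2) * hd

lemma exists_chi (H : Subgroup (ProjectiveSpecialLinearGroup (Fin 2) F)) (v : Fin 2 → L)
    (hv : v ≠ 0) :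
    ∃ χ : stabilizer H (pt F v hv) →* Lˣ, ∀ (s : stabilizer H (pt F v hv))
      (g : SpecialLinearGroup (Fin 2) F) (l : L), toPSL g = ((s : H) : _) →
      lact L g v = l • v → (χ s : L) = l ^ 2 := by
  have hex : ∀ s : stabilizer H (pt F v hv), ∃ (g : SpecialLinearGroup (Fin 2) F) (l : L),
      toPSL g = ((s : H) : ProjectiveSpecialLinearGroup (Fin 2) F) ∧ lact L g v = l • v := by
    rintro ⟨⟨h, hH⟩, hs⟩
    obtain ⟨g, rfl⟩ := toPSL_surj h
    have hs' : toPSL g • pt F v hv = pt F v hv := hs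
    obtain ⟨l, hl⟩ := (smul_pt_iff g v v hv hv).mp hs'
    exact ⟨g, l, rfl, hl⟩
  choose G l hG hl using hex
  have hne : ∀ s, l s ≠ 0 := fun s => root_ne_zero (eig_root (G s) v hv (l s) (hl s))
  let f : stabilizer H (pt F v hv) → Lˣ := fun s => (Units.mk0 (l s) (hne s)) ^ 2
  have hf : ∀ (s : stabilizer H (pt F v hv)) (g : SpecialLinearGroup (Fin 2) F) (m : L),
      toPSL g = ((s : H) : ProjectiveSpecialLinearGroup (Fin 2) F) →
      lact L g v = m • v → (f s : L) = m ^ 2 := by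
    intro s g m h1 h2
    simp only [f, Units.val_pow_eq_pow_val, Units.val_mk0]
    exact lift_sq (G s) g ((hG s).trans h1.symm) v hv _ _ (hl s) h2
  refine ⟨MonoidHom.mk' f ?_, hf⟩
  intro a b
  apply Units.ext
  have h1 : toPSL (G a * G b) = (((a * b : stabilizer H (pt F v hv)) : H) :
      ProjectiveSpecialLinearGroup (Fin 2) F) := by
    have : toPSL (G a * G b) = toPSL (G a) * toPSL (G b) := rfl
    rw [this, hG a, hG b]; rfl
  rw [hf (a * b) (G a * G b) (l a * l b) h1 ?_]
  · simp only [f, Units.val_mul, Units.val_pow_eq_pow_val, Units.val_mk0]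
    ring
  · rw [lact_mul, hl b, lact_smul, hl a, smul_smul, mul_comm]

lemma uni_iff (g : SpecialLinearGroup (Fin 2) F) (v : Fin 2 → L) (hv : v ≠ 0) (l : L)
    (hl : lact L g v = l • v) :
    l ^ 2 = 1 ↔ toPSL g = 1 ∨ fixedBy (PLine F L) (toPSL g) = {pt F v hv} := by
  have hr := eig_root g v hv l hl
  have hl0 := root_ne_zero hr
  constructor
  · intro h2
    by_cases h1 : toPSL g = 1
    · exact Or.inl h1
    right
    ext y
    rw [mem_fixedBy, Set.mem_singleton_iff]
    constructor
    · intro hy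
      obtain ⟨w, hw, rfl⟩ := exists_pt y
      obtain ⟨m, hm⟩ := (smul_pt_iff g w w hw hw).mp hy
      by_contra hne
      rw [pt_eq_iff_crs] at hne
      have e := eig_mul g w v m l hm hl hne
      have : m = l := by
        apply mul_right_cancel₀ hl0
        rw [e, ← sq, h2]
      subst this
      exact h1 (scalar_of g w v m hm hl hne)
    · rintro rfl
      exact (smul_pt_iff g v v hv hv).mpr ⟨l, hl⟩
  · rintro (h | h)
    · rw [toPSL_eq_one] at h
      obtain ⟨z1, z2, z3⟩ := h
      have hzv : lact L g v = algebraMap F L (g 0 0) • v := by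
        ext i; fin_cases i <;> simp [lact, z1, z2, z3]
      rw [eig_unique g v hv _ _ hl hzv]
      have hd := det_eqL L g
      rw [← z3, z1, map_zero] at hd
      linear_combination hd
    · have hr' : l⁻¹ ^ 2 - algebraMap F L (g 0 0 + g 1 1) * l⁻¹ + 1 = 0 := by
        field_simp
        linear_combination hr
      obtain ⟨w, hw, hwl⟩ := exists_eig g l⁻¹ hr'
      have hmem : pt F w hw ∈ fixedBy (PLine F L) (toPSL g) :=
        (smul_pt_iff g w w hw hw).mpr ⟨_, hwl⟩
      rw [h, Set.mem_singleton_iff, pt_eq_iff] at hmem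
      obtain ⟨c, rfl⟩ := hmem
      have hc : c ≠ 0 := by rintro rfl; simp at hw
      rw [lact_smul, hl, smul_smul, smul_smul] at hwl
      have := smul_left_injective L hv hwl
      have h3 : l = l⁻¹ := by
        apply mul_left_cancel₀ hc
        rw [this, mul_comm]
      rw [sq]
      nth_rewrite 2 [h3]
      exact mul_inv_cancel₀ hl0

lemma card_ker [Finite F] (H : Subgroup (ProjectiveSpecialLinearGroup (Fin 2) F))
    (v : Fin 2 → L) (hv : v ≠ 0)
    (χ : stabilizer H (pt F v hv) →* Lˣ) (hχ : ∀ (s : stabilizer H (pt F v hv))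
      (g : SpecialLinearGroup (Fin 2) F) (l : L), toPSL g = ((s : H) : _) →
      lact L g v = l • v → (χ s : L) = l ^ 2) :
    Nat.card χ.ker = uniCard H (pt F v hv) := by
  have hk : ∀ s : stabilizer H (pt F v hv), s ∈ χ.ker ↔
      ((s : H) = 1 ∨ fixedBy (PLine F L) (s : H) = {pt F v hv}) := by
    rintro ⟨⟨h, hH⟩, hs⟩
    obtain ⟨g, rfl⟩ := toPSL_surj h
    have hs' : toPSL g • pt F v hv = pt F v hv := hs
    obtain ⟨l, hl⟩ := (smul_pt_iff g v v hv hv).mp hs'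
    rw [MonoidHom.mem_ker, ← Units.val_eq_one, hχ _ g l rfl hl, uni_iff g v hv l hl]
    rw [← Subtype.coe_inj]
    rfl
  have e : χ.ker ≃ ((insert 1 {h : H | h ≠ 1 ∧ fixedBy (PLine F L) h = {pt F v hv}} : Set H)) :=
    { toFun := fun s => ⟨s.1.1, by
        have := (hk s.1).mp s.2
        by_cases h1 : (s.1.1 : H) = 1
        · left; exact h1
        · right; exact ⟨h1, this.resolve_left h1⟩⟩
      invFun := fun h => ⟨⟨h.1, by
          rcases h.2 with h1 | h1
          · rw [h1]; exact one_mem _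
          · have : pt F v hv ∈ fixedBy (PLine F L) (h.1) := by rw [h1.2]; rfl
            exact this⟩, by
          rw [hk]
          rcases h.2 with h1 | h1
          · left; exact h1
          · right; exact h1.2⟩
      left_inv := fun s => rfl
      right_inv := fun s => rfl }
  rw [Nat.card_congr e, Nat.card_coe_set_eq, Set.ncard_insert_of_notMem (by simp) (Set.toFinite _)]
  rfl

lemma uni_lift (g : SpecialLinearGroup (Fin 2) F) (v : Fin 2 → L) (l : L)
    (hl : lact L g v = l • v) (h2 : l ^ 2 = 1) :
    ∃ g' : SpecialLinearGroup (Fin 2) F, toPSL g' = toPSL g ∧ lact L g' v = v := by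
  have h3 : (l - 1) * (l + 1) = 0 := by linear_combination h2
  have h4 : l = 1 ∨ l = -1 := by
    rcases mul_eq_zero.mp h3 with h | h
    · left; linear_combination h
    · right; linear_combination h
  rcases h4 with h | h
  · exact ⟨g, rfl, by rw [hl, h, one_smul]⟩
  · refine ⟨-g, ?_, ?_⟩
    · apply QuotientGroup.eq.mpr
      rw [center_iff]
      have : (-g)⁻¹ * g = -1 := by
        rw [inv_mul_eq_iff_eq_mul]; simp
      rw [this]; simp
    · have : lact L (-g) v = - lact L g v := by
        ext i; fin_cases i <;> simp [lact] <;> ring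
      rw [this, hl, h]; simp

lemma uni_pow (p : ℕ) [hp : Fact p.Prime] [CharP F p] (g : SpecialLinearGroup (Fin 2) F)
    (v : Fin 2 → L) (hv : v ≠ 0) (h : lact L g v = v) : g ^ p = 1 := by
  have hr := eig_root g v hv 1 (by rw [h, one_smul])
  have ht : g 0 0 + g 1 1 = 2 := by
    apply (algebraMap F L).injective
    rw [map_ofNat]
    linear_combination -hr
  have hd := det_eq g
  have hsq : ((g : Matrix (Fin 2) (Fin 2) F) - 1) ^ 2 = 0 := by
    have e : g 1 1 = 2 - g 0 0 := by linear_combination ht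
    rw [e] at hd
    rw [sq]
    ext i j
    fin_cases i <;> fin_cases j <;> simp [Matrix.mul_apply, Fin.sum_univ_two, e]
    · linear_combination -hd
    · ring
    · ring
    · linear_combination -hd
  apply Subtype.ext
  change ((g ^ p : SpecialLinearGroup (Fin 2) F) : Matrix (Fin 2) (Fin 2) F) = 1
  rw [Matrix.SpecialLinearGroup.coe_pow]
  have h1 : ((g : Matrix (Fin 2) (Fin 2) F) - 1) ^ p = (g : Matrix (Fin 2) (Fin 2) F) ^ p - 1 := by
    rw [sub_pow_char_of_commute p (Commute.one_right _), one_pow]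
  have h2 : ((g : Matrix (Fin 2) (Fin 2) F) - 1) ^ p = 0 :=
    pow_eq_zero_of_le hp.out.two_le hsq
  rw [h2] at h1
  exact (sub_eq_zero.mp h1.symm)

/-- Rational points. -/
def RatPt (x : PLine F L) : Prop :=
  ∃ (u : Fin 2 → F) (_ : u ≠ 0) (hv : (fun i => algebraMap F L (u i)) ≠ 0),
    x = pt F (fun i => algebraMap F L (u i)) hv

lemma map_vec_ne {u : Fin 2 → F} (hu : u ≠ 0) : (fun i => algebraMap F L (u i)) ≠ 0 := by
  intro h
  apply hu
  ext i
  apply (algebraMap F L).injective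
  simpa using congrFun h i

lemma lact_map (g : SpecialLinearGroup (Fin 2) F) (u : Fin 2 → F) :
    lact L g (fun i => algebraMap F L (u i)) = fun i => algebraMap F L (lact F g u i) := by
  ext i; fin_cases i <;> simp [lact]

lemma rat_of_eig (g : SpecialLinearGroup (Fin 2) F) (hg : toPSL g ≠ 1) (v : Fin 2 → L)
    (hv : v ≠ 0) (m : F) (hl : lact L g v = algebraMap F L m • v) : RatPt (pt F v hv) := by
  have hr := eig_root g v hv _ hl
  have hr' : m ^ 2 - algebraMap F F (g 0 0 + g 1 1) * m + 1 = 0 := by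
    apply (algebraMap F L).injective
    simp only [map_add, map_sub, map_mul, map_pow, map_one, map_zero] at hr ⊢
    simpa using hr
  obtain ⟨u, hu, hul⟩ := exists_eig (L := F) g m hr'
  refine ⟨u, hu, map_vec_ne hu, ?_⟩
  by_contra hne
  rw [pt_eq_iff_crs] at hne
  apply hg
  refine scalar_of g v (fun i => algebraMap F L (u i)) _ hl ?_ hne
  rw [lact_map, hul]
  ext i; simp

lemma mem_of_pow_card [Fintype F] (l : L) (hl : l ^ Fintype.card F = l) :
    ∃ m : F, algebraMap F L m = l := by
  classical
  by_contra hne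
  push Not at hne
  have hq : 1 < Fintype.card F := Fintype.one_lt_card
  have hsub : (insert l (Finset.univ.image (algebraMap F L))).val ⊆
      (Polynomial.X ^ Fintype.card F - Polynomial.X : Polynomial L).roots := by
    intro y hy
    have hy' : y ∈ insert l (Finset.univ.image (algebraMap F L)) := hy
    rw [Polynomial.mem_roots (FiniteField.X_pow_card_sub_X_ne_zero L hq)]
    simp only [Finset.mem_insert, Finset.mem_image, Finset.mem_univ, true_and] at hy'
    rcases hy' with rfl | ⟨a, rfl⟩
    · simp [hl]
    · simp [← map_pow, FiniteField.pow_card]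
  have := Polynomial.card_le_degree_of_subset_roots hsub
  rw [FiniteField.X_pow_card_sub_X_natDegree_eq L hq, Finset.card_insert_of_notMem,
    Finset.card_image_of_injective _ (algebraMap F L).injective, Finset.card_univ] at this
  · omega
  · simpa using hne

end Stab

section Struct
open MulAction

variable {F L : Type} [Field F] [Field L] [Algebra F L]

lemma card_dvd_of_pow [Finite L] (K : Subgroup Lˣ) (m : ℕ) (h : ∀ k ∈ K, k ^ m = 1) :
    Nat.card K ∣ m := by
  obtain ⟨g, hg⟩ := IsCyclic.exists_generator (α := K)
  have : orderOf g = Nat.card K := orderOf_eq_card_of_forall_mem_zpowers hg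
  rw [← this]
  apply orderOf_dvd_of_pow_eq_one
  apply Subtype.ext
  simpa using h g g.2

/-- The eigenvalue at a non-rational point. -/
lemma nonrat_pow [Fintype F] [Finite L] (d : ℕ) (hd : d = Nat.gcd 2 (Fintype.card F - 1))
    (g : SpecialLinearGroup (Fin 2) F) (v : Fin 2 → L) (hv : v ≠ 0) (l : L)
    (hl : lact L g v = l • v) (hrat : ¬ RatPt (pt F v hv)) :
    (l ^ 2) ^ ((Fintype.card F + 1) / d) = 1 := by
  by_cases h1 : toPSL g = 1
  · rw [(uni_iff g v hv l hl).mpr (Or.inl h1), one_pow]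
  have hr := eig_root g v hv l hl
  have hl0 := root_ne_zero hr
  have hnot : ¬ ∃ m : F, algebraMap F L m = l := by
    rintro ⟨m, rfl⟩
    exact hrat (rat_of_eig g h1 v hv m hl)
  have hne : l ^ Fintype.card F ≠ l := fun h => hnot (mem_of_pow_card l h)
  have hr2 : (l ^ Fintype.card F) ^ 2 - algebraMap F L (g 0 0 + g 1 1) * l ^ Fintype.card F
      + 1 = 0 := by
    have := congrArg (FiniteField.frobeniusAlgHom F L) hr
    rw [map_add, map_sub, map_mul, map_pow, AlgHom.commutes, map_one, map_zero,
      FiniteField.coe_frobeniusAlgHom] at this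
    exact this
  have hprod : (l ^ Fintype.card F - l) * (l ^ Fintype.card F * l - 1) = 0 := by
    linear_combination l * hr2 - l ^ Fintype.card F * hr
  have hq1 : l ^ (Fintype.card F + 1) = 1 := by
    rcases mul_eq_zero.mp hprod with h | h
    · exact absurd (sub_eq_zero.mp h) hne
    · rw [pow_succ]; linear_combination h
  have hd2 : d ∣ 2 := hd ▸ Nat.gcd_dvd_left _ _
  have hdq : d ∣ Fintype.card F + 1 := by
    have h2 : d ∣ Fintype.card F - 1 := hd ▸ Nat.gcd_dvd_right _ _
    have : Fintype.card F + 1 = (Fintype.card F - 1) + 2 := by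
      have : 0 < Fintype.card F := Fintype.card_pos
      omega
    rw [this]; exact dvd_add h2 hd2
  rw [← pow_mul]
  obtain ⟨a, ha⟩ := hd2
  have : 2 * ((Fintype.card F + 1) / d) = (Fintype.card F + 1) * a := by
    conv_lhs => rw [ha]
    rw [mul_assoc, mul_comm a, ← mul_assoc, Nat.mul_div_cancel' hdq]
  rw [this, pow_mul, hq1, one_pow]

lemma rat_pow [Fintype F] (d : ℕ) (hd : d = Nat.gcd 2 (Fintype.card F - 1))
    (g : SpecialLinearGroup (Fin 2) F) (u : Fin 2 → F) (hu : u ≠ 0) (l : L)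
    (hl : lact L g (fun i => algebraMap F L (u i)) = l • (fun i => algebraMap F L (u i))) :
    (∃ m : F, algebraMap F L m = l) ∧ (l ^ 2) ^ ((Fintype.card F - 1) / d) = 1 := by
  have hl0 := root_ne_zero (eig_root g _ (map_vec_ne hu) l hl)
  have hm : ∃ m : F, algebraMap F L m = l := by
    rw [lact_map] at hl
    have key : ∀ i, u i ≠ 0 → algebraMap F L (lact F g u i / u i) = l := by
      intro i hi
      have := congrFun hl i
      simp only [Pi.smul_apply, smul_eq_mul] at this
      rw [map_div₀, this]
      have : algebraMap F L (u i) ≠ 0 := by simpa using hi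
      field_simp
    rcases vec_ne_zero hu with h | h
    · exact ⟨_, key 0 h⟩
    · exact ⟨_, key 1 h⟩
  refine ⟨hm, ?_⟩
  obtain ⟨m, rfl⟩ := hm
  have hm0 : m ≠ 0 := by rintro rfl; simp at hl0
  have hd2 : d ∣ 2 := hd ▸ Nat.gcd_dvd_left _ _
  have hdq : d ∣ Fintype.card F - 1 := hd ▸ Nat.gcd_dvd_right _ _
  rw [← pow_mul]
  obtain ⟨a, ha⟩ := hd2
  have : 2 * ((Fintype.card F - 1) / d) = (Fintype.card F - 1) * a := by
    conv_lhs => rw [ha]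
    rw [mul_assoc, mul_comm a, ← mul_assoc, Nat.mul_div_cancel' hdq]
  rw [this, pow_mul, ← map_pow, FiniteField.pow_card_sub_one_eq_one m hm0, map_one, one_pow]

lemma ratpt_of_uni [Finite F] (H : Subgroup (ProjectiveSpecialLinearGroup (Fin 2) F))
    (x : PLine F L) (hx : uniCard H x ≠ 1) : RatPt x := by
  have : ∃ h : H, h ≠ 1 ∧ fixedBy (PLine F L) h = {x} := by
    by_contra hne
    apply hx
    have : IsEmpty {h : H // h ≠ 1 ∧ fixedBy (PLine F L) h = {x}} :=
      ⟨fun h => hne ⟨h.1, h.2⟩⟩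
    unfold uniCard
    rw [Nat.card_of_isEmpty]
  obtain ⟨⟨h, hH⟩, h1, h2⟩ := this
  obtain ⟨g, rfl⟩ := toPSL_surj h
  obtain ⟨v, hv, rfl⟩ := exists_pt x
  have h1' : toPSL g ≠ 1 := fun h => h1 (Subtype.ext h)
  have h2' : fixedBy (PLine F L) (toPSL g) = {pt F v hv} := h2
  have hmem : pt F v hv ∈ fixedBy (PLine F L) (toPSL g) := by rw [h2']; rfl
  obtain ⟨l, hl⟩ := (smul_pt_iff g v v hv hv).mp hmem
  have hl2 := (uni_iff g v hv l hl).mpr (Or.inr h2')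
  have h3 : (l - 1) * (l + 1) = 0 := by linear_combination hl2
  rcases mul_eq_zero.mp h3 with h | h
  · refine rat_of_eig g h1' v hv 1 ?_
    rw [hl, map_one]; congr 1; linear_combination h
  · refine rat_of_eig g h1' v hv (-1) ?_
    rw [hl, map_neg, map_one]; congr 1; linear_combination h

lemma stab_struct [Fintype F] [Finite L] (p : ℕ) [Fact p.Prime] [CharP F p]
    (d : ℕ) (hd : d = Nat.gcd 2 (Fintype.card F - 1))
    (H : Subgroup (ProjectiveSpecialLinearGroup (Fin 2) F)) (x : PLine F L) :
    ∃ c, Nat.card (stabilizer H x) = uniCard H x * c ∧ (∃ k, uniCard H x = p ^ k) ∧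
      ((RatPt x ∧ c ∣ (Fintype.card F - 1) / d) ∨
        (¬ RatPt x ∧ uniCard H x = 1 ∧ c ∣ (Fintype.card F + 1) / d)) := by
  have main : ∀ (v : Fin 2 → L) (hv : v ≠ 0), ∃ χ : stabilizer H (pt F v hv) →* Lˣ,
      (∀ (s : stabilizer H (pt F v hv))
      (g : SpecialLinearGroup (Fin 2) F) (l : L), toPSL g = ((s : H) : _) →
      lact L g v = l • v → (χ s : L) = l ^ 2) ∧
      Nat.card (stabilizer H (pt F v hv)) = uniCard H (pt F v hv) * Nat.card χ.range ∧
      (∃ k, uniCard H (pt F v hv) = p ^ k) := by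
    intro v hv
    obtain ⟨χ, hχ⟩ := exists_chi H v hv
    refine ⟨χ, hχ, ?_, ?_⟩
    · rw [← card_ker H v hv χ hχ, ← Subgroup.index_ker, Subgroup.card_mul_index]
    · rw [← card_ker H v hv χ hχ]
      have : IsPGroup p χ.ker := by
        rintro ⟨s, hs⟩
        refine ⟨1, ?_⟩
        rw [pow_one]
        have hs1 : χ s = 1 := hs
        obtain ⟨⟨h, hH⟩, hst⟩ := s
        obtain ⟨g, rfl⟩ := toPSL_surj h
        have hs' : toPSL g • pt F v hv = pt F v hv := hst
        obtain ⟨l, hl⟩ := (smul_pt_iff g v v hv hv).mp hs'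
        have h2 : l ^ 2 = 1 := by
          rw [← hχ ⟨⟨toPSL g, hH⟩, hst⟩ g l rfl hl, hs1]; rfl
        obtain ⟨g', hg', hg'v⟩ := uni_lift g v l hl h2
        have hp := uni_pow p g' v hv hg'v
        apply Subtype.ext
        apply Subtype.ext
        apply Subtype.ext
        change (toPSL g) ^ p = 1
        rw [← hg']
        have : toPSL (g' ^ p) = toPSL g' ^ p := map_pow _ _ _
        rw [← this, hp]; rfl
      exact IsPGroup.iff_card.mp this
  have range_pow : ∀ (v : Fin 2 → L) (hv : v ≠ 0) (m : ℕ)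
      (_ : ∀ (g : SpecialLinearGroup (Fin 2) F) (l : L), lact L g v = l • v → (l ^ 2) ^ m = 1)
      (χ : stabilizer H (pt F v hv) →* Lˣ) (_ : ∀ (s : stabilizer H (pt F v hv))
      (g : SpecialLinearGroup (Fin 2) F) (l : L), toPSL g = ((s : H) : _) →
      lact L g v = l • v → (χ s : L) = l ^ 2), Nat.card χ.range ∣ m := by
    intro v hv m hm χ hχ
    apply card_dvd_of_pow
    rintro _ ⟨⟨⟨h, hH⟩, hst⟩, rfl⟩
    obtain ⟨g, rfl⟩ := toPSL_surj h
    have hs' : toPSL g • pt F v hv = pt F v hv := hst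
    obtain ⟨l, hl⟩ := (smul_pt_iff g v v hv hv).mp hs'
    apply Units.ext
    rw [Units.val_pow_eq_pow_val, hχ _ g l rfl hl, hm g l hl]
    rfl
  by_cases hrat : RatPt x
  · have hrat' := hrat
    obtain ⟨u, hu, hv, rfl⟩ := hrat'
    obtain ⟨χ, hχ, hc, hk⟩ := main _ hv
    refine ⟨_, hc, hk, Or.inl ⟨hrat, ?_⟩⟩
    exact range_pow _ hv _ (fun g l hl => (rat_pow d hd g u hu l hl).2) χ hχ
  · obtain ⟨v, hv, rfl⟩ := exists_pt x
    obtain ⟨χ, hχ, hc, hk⟩ := main _ hv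
    refine ⟨_, hc, hk, Or.inr ⟨hrat, ?_, ?_⟩⟩
    · by_contra h
      exact hrat (ratpt_of_uni H _ h)
    · exact range_pow _ hv _ (fun g l hl => nonrat_pow d hd g v hv l hl hrat) χ hχ

end Struct

section LemF
open MulAction

variable {F L : Type} [Field F] [Field L] [Algebra F L]

/-- The transvections fixing `u`. -/
def tv (u : Fin 2 → F) (b : F) : SpecialLinearGroup (Fin 2) F :=
  ⟨!![1 - b * u 0 * u 1, b * u 0 ^ 2; -(b * u 1 ^ 2), 1 + b * u 0 * u 1], by
    rw [Matrix.det_fin_two_of]; ring⟩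

lemma tv_act (u v : Fin 2 → F) (b : F) :
    lact F (tv u b) v = v + (b * crs u v) • u := by
  ext i; fin_cases i <;> simp [lact, tv, crs] <;> ring

lemma tv_fix (u : Fin 2 → F) (b : F) : lact F (tv u b) u = u := by
  rw [tv_act]; simp [crs, mul_comm]

lemma lact_one (v : Fin 2 → F) : lact (F := F) F 1 v = v := by
  ext i; fin_cases i <;> simp [lact]

lemma lact_inv {g : SpecialLinearGroup (Fin 2) F} {v w : Fin 2 → F} (h : lact F g v = w) :
    lact F g⁻¹ w = v := by
  rw [← h, ← lact_mul, inv_mul_cancel, lact_one]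

lemma lact_mulVec (g : SpecialLinearGroup (Fin 2) F) (v : Fin 2 → F) :
    (g : Matrix (Fin 2) (Fin 2) F).mulVec v = lact F g v := by
  ext i
  fin_cases i <;> simp [lact, Matrix.mulVec, dotProduct, Fin.sum_univ_two]

lemma fix_eq_tv (g : SpecialLinearGroup (Fin 2) F) (u : Fin 2 → F) (hu : u ≠ 0)
    (h : lact F g u = u) : ∃ b, tv u b = g := by
  have hr := eig_root g u hu 1 (by rw [h, one_smul])
  simp only [Algebra.algebraMap_self, RingHom.id_apply] at hr
  have h0 := congrFun h 0
  have h1 := congrFun h 1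
  simp only [lact, Algebra.algebraMap_self, RingHom.id_apply, Matrix.cons_val_zero,
    Matrix.cons_val_one] at h0 h1
  rcases vec_ne_zero hu with h | h
  · refine ⟨g 0 1 / u 0 ^ 2, ?_⟩
    have e00 : g 0 0 = 1 - g 0 1 * u 1 / u 0 := by field_simp; linear_combination h0
    have e11 : g 1 1 = 1 + g 0 1 * u 1 / u 0 := by linear_combination -e00 - hr
    have e10 : g 1 0 = - (g 0 1 * u 1 ^ 2 / u 0 ^ 2) := by
      rw [e11] at h1
      field_simp at h1 ⊢
      linear_combination h1
    ext i j
    fin_cases i <;> fin_cases j <;> simp [tv, e00, e11, e10] <;> field_simp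
  · refine ⟨- (g 1 0 / u 1 ^ 2), ?_⟩
    have e11 : g 1 1 = 1 - g 1 0 * u 0 / u 1 := by field_simp; linear_combination h1
    have e00 : g 0 0 = 1 + g 1 0 * u 0 / u 1 := by linear_combination -e11 - hr
    have e01 : g 0 1 = - (g 1 0 * u 0 ^ 2 / u 1 ^ 2) := by
      rw [e00] at h0
      field_simp at h0 ⊢
      linear_combination h0
    ext i j
    fin_cases i <;> fin_cases j <;> simp [tv, e00, e11, e01] <;> field_simp
    ring

lemma all_uni [Fintype F] (H : Subgroup (ProjectiveSpecialLinearGroup (Fin 2) F))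
    (u : Fin 2 → F) (hu : u ≠ 0) (hv : (fun i => algebraMap F L (u i)) ≠ 0)
    (hcard : Fintype.card F ≤ uniCard H (pt F (fun i => algebraMap F L (u i)) hv))
    (g : SpecialLinearGroup (Fin 2) F) (hg : lact F g u = u) : toPSL g ∈ H := by
  set x : PLine F L := pt F (fun i => algebraMap F L (u i)) hv with hx
  let S : Set (ProjectiveSpecialLinearGroup (Fin 2) F) :=
    (fun b => toPSL (tv u b)) '' (Set.univ : Set F)
  let T : Set (ProjectiveSpecialLinearGroup (Fin 2) F) :=
    (fun h : H => (h : ProjectiveSpecialLinearGroup (Fin 2) F)) ''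
      (insert 1 {h : H | h ≠ 1 ∧ fixedBy (PLine F L) h = {x}})
  have hS : S.ncard ≤ Fintype.card F := by
    refine (Set.ncard_image_le Set.finite_univ).trans ?_
    rw [Set.ncard_univ, Nat.card_eq_fintype_card]
  have hT : T.ncard = uniCard H x := by
    rw [Set.ncard_image_of_injective _ Subtype.val_injective,
      Set.ncard_insert_of_notMem (by simp) (Set.toFinite _)]
    rfl
  have hTS : T ⊆ S := by
    rintro _ ⟨⟨h, hH⟩, hh, rfl⟩
    rcases hh with h1 | ⟨h1, h2⟩
    · refine ⟨0, Set.mem_univ _, ?_⟩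
      have : tv u 0 = 1 := by
        ext i j; fin_cases i <;> fin_cases j <;> simp [tv]
      have h1' : h = 1 := congrArg Subtype.val h1
      simp only [this, h1']
      rfl
    · obtain ⟨g, rfl⟩ := toPSL_surj h
      have h2' : fixedBy (PLine F L) (toPSL g) = {x} := h2
      have hmem : x ∈ fixedBy (PLine F L) (toPSL g) := by rw [h2']; rfl
      obtain ⟨l, hl⟩ := (smul_pt_iff g _ _ hv hv).mp hmem
      have hl2 := (uni_iff g _ hv l hl).mpr (Or.inr h2')
      obtain ⟨g', hg', hg'v⟩ := uni_lift g _ l hl hl2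
      have : lact F g' u = u := by
        rw [lact_map] at hg'v
        ext i
        exact (algebraMap F L).injective (congrFun hg'v i)
      obtain ⟨b, hb⟩ := fix_eq_tv g' u hu this
      exact ⟨b, Set.mem_univ _, by simp only [hb]; exact hg'⟩
  have hEq : T = S := Set.eq_of_subset_of_ncard_le hTS (by omega) (Set.toFinite _)
  obtain ⟨b, rfl⟩ := fix_eq_tv g u hu hg
  have : toPSL (tv u b) ∈ T := by
    rw [hEq]; exact ⟨b, Set.mem_univ _, rfl⟩
  obtain ⟨h, -, h2⟩ := this
  rw [← h2]; exact h.2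

lemma crs_zero (u w : Fin 2 → F) (hu : u ≠ 0) (h : crs u w = 0) : ∃ c : F, w = c • u := by
  unfold crs at h
  rcases vec_ne_zero hu with h0 | h0
  · refine ⟨w 0 / u 0, ?_⟩
    ext i; fin_cases i
    · simp; field_simp
    · simp; field_simp; linear_combination h
  · refine ⟨w 1 / u 1, ?_⟩
    ext i; fin_cases i
    · simp; field_simp; linear_combination -h
    · simp; field_simp

lemma top_of_uni [Fintype F] (H : Subgroup (ProjectiveSpecialLinearGroup (Fin 2) F))
    (x : PLine F L) (hrat : RatPt x) (hcard : Fintype.card F ≤ uniCard H x)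
    (hstr : ¬ ∃ v : Fin 2 → F, v ≠ 0 ∧ ∀ A : SpecialLinearGroup (Fin 2) F,
      toPSL A ∈ H → ∃ c : F, (A : Matrix (Fin 2) (Fin 2) F).mulVec v = c • v) : H = ⊤ := by
  obtain ⟨u, hu, hv, rfl⟩ := hrat
  let K : Subgroup (SpecialLinearGroup (Fin 2) F) :=
    H.comap (QuotientGroup.mk' (Subgroup.center (SpecialLinearGroup (Fin 2) F)))
  have hKu : ∀ g, lact F g u = u → g ∈ K := fun g hg => all_uni H u hu hv hcard g hg
  push Not at hstr
  obtain ⟨s, hs, hsu⟩ := hstr u hu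
  have hsK : s ∈ K := hs
  obtain ⟨w, hw⟩ : ∃ w, lact F s u = w := ⟨_, rfl⟩
  rw [lact_mulVec, hw] at hsu
  have hD : crs u w ≠ 0 := by
    intro h
    obtain ⟨c, hc⟩ := crs_zero u w hu h
    exact hsu c hc
  have hKw : ∀ g, lact F g w = w → g ∈ K := by
    intro g hg
    have h1 : s⁻¹ * g * s ∈ K := by
      apply hKu
      rw [lact_mul, lact_mul, hw, hg]
      exact lact_inv hw
    have : g = s * (s⁻¹ * g * s) * s⁻¹ := by group
    rw [this]
    exact K.mul_mem (K.mul_mem hsK h1) (K.inv_mem hsK)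
  have claim1 : ∀ y : Fin 2 → F, crs u y ≠ 0 → ∃ k ∈ K, lact F k u = y := by
    intro y hy
    have hD' : crs w u ≠ 0 := by
      intro h; apply hD; unfold crs at h ⊢; linear_combination -h
    set β := crs u y / crs u w with hβ
    have hβ0 : β ≠ 0 := div_ne_zero hy hD
    set α := crs y w / crs u w with hα
    refine ⟨tv u ((α - 1) / (β * crs u w)) * tv w (β / crs w u), K.mul_mem (hKu _ (tv_fix _ _))
      (hKw _ (tv_fix _ _)), ?_⟩
    rw [lact_mul, tv_act w u, div_mul_cancel₀ _ hD', tv_act]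
    have e1 : crs u (u + β • w) = β * crs u w := by
      simp only [crs, Pi.add_apply, Pi.smul_apply, smul_eq_mul]; ring
    rw [e1, div_mul_cancel₀ _ (mul_ne_zero hβ0 hD)]
    have e2 : y = α • u + β • w := by
      rw [hα, hβ]
      ext i; fin_cases i
      · simp only [Fin.zero_eta, Pi.add_apply, Pi.smul_apply, smul_eq_mul]
        field_simp
        simp only [crs]; ring
      · simp only [Fin.mk_one, Pi.add_apply, Pi.smul_apply, smul_eq_mul]
        field_simp
        simp only [crs]; ring
    rw [e2]
    ext i
    simp only [Pi.add_apply, Pi.smul_apply, smul_eq_mul]; ring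
  have claim2 : ∀ y : Fin 2 → F, y ≠ 0 → ∃ k ∈ K, lact F k u = y := by
    intro y hy
    by_cases h : crs u y = 0
    · obtain ⟨c, rfl⟩ := crs_zero u y hu h
      have hc : c ≠ 0 := by rintro rfl; simp at hy
      obtain ⟨k, hk, hku⟩ := claim1 (lact F (tv w 1) (c • u)) (by
        rw [tv_act]
        have : crs u (c • u + (1 * crs w (c • u)) • w) = - (c * crs u w ^ 2) := by
          simp only [crs, Pi.add_apply, Pi.smul_apply, smul_eq_mul]; ring
        rw [this]
        exact neg_ne_zero.mpr (mul_ne_zero hc (pow_ne_zero _ hD)))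
      refine ⟨(tv w 1)⁻¹ * k, K.mul_mem (K.inv_mem (hKw _ (tv_fix _ _))) hk, ?_⟩
      rw [lact_mul, hku]
      exact lact_inv rfl
    · exact claim1 y h
  rw [eq_top_iff]
  intro h _
  obtain ⟨a, rfl⟩ := toPSL_surj h
  have hne : lact F a u ≠ 0 := by
    intro h0
    apply hu
    rw [← lact_inv h0]
    ext i; fin_cases i <;> simp [lact]
  obtain ⟨k, hk, hku⟩ := claim2 _ hne
  have h1 : k⁻¹ * a ∈ K := by
    apply hKu
    rw [lact_mul]
    exact lact_inv hku
  have : k * (k⁻¹ * a) ∈ K := K.mul_mem hk h1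
  rw [mul_inv_cancel_left] at this
  exact this

end LemF

section Arith

lemma ar_s {s Q n c : ℕ} (he : s * Q * n + 2 = s * Q * c + 2 * s * n) : s = 1 ∨ s = 2 := by
  have h : s ∣ 2 := by
    have h1 : s ∣ s * Q * n + 2 := by
      rw [he]; exact ⟨Q * c + 2 * n, by ring⟩
    exact (Nat.dvd_add_right ⟨Q * n, by ring⟩).mp h1
  have := Nat.le_of_dvd (by norm_num) h
  have : s ≠ 0 := by rintro rfl; simp at h
  omega

lemma ar_split {s Q n c : ℕ} (hn : 6 ≤ n) (hQ : 3 ≤ Q) (hc1 : 1 ≤ c) (hc : c ∣ n)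
    (he : s * Q * n + 2 = s * Q * c + 2 * s * n) : False := by
  have h : c ∣ 2 := by
    have h1 : c ∣ s * Q * n + 2 := by
      rw [he]
      exact dvd_add (dvd_mul_left _ _) (hc.mul_left _)
    exact (Nat.dvd_add_right (hc.mul_left _)).mp h1
  have hc2 := Nat.le_of_dvd (by norm_num) h
  obtain ⟨e, rfl⟩ := Nat.exists_eq_add_of_le (show c ≤ n by omega)
  rcases ar_s he with rfl | rfl <;> nlinarith

lemma ar_uni {p k f q d n Q : ℕ} (hp : p.Prime) (hf : f ≠ 0) (hq : q = p ^ f) (hQ : Q = p ^ k)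
    (hQ1 : Q ≠ 1) (hd : d ∣ 2) (hn : d * n = q - 1) (hn6 : 6 ≤ n) (hdvd : n ∣ Q - 1) :
    q ≤ Q := by
  by_contra hlt
  have hk : k ≠ 0 := by rintro rfl; simp at hQ; exact hQ1 hQ
  have hpQ : p ∣ Q := hQ ▸ dvd_pow_self p hk
  have hpq : p ∣ q := hq ▸ dvd_pow_self p hf
  have hQ0 : 0 < Q := hQ ▸ pow_pos hp.pos k
  obtain ⟨j, hj⟩ := hdvd
  have hd2 := Nat.le_of_dvd (by norm_num) hd
  have hd0 : d ≠ 0 := by rintro rfl; simp at hd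
  have hj0 : j ≠ 0 := by rintro rfl; simp at hj; omega
  have hnj : n * 1 ≤ n * j := Nat.mul_le_mul_left _ (by omega)
  have : d = 1 ∨ d = 2 := by omega
  rcases this with rfl | rfl
  · omega
  · have hj1 : j = 1 := by
      by_contra h
      have : n * 2 ≤ n * j := Nat.mul_le_mul_left _ (by omega)
      omega
    subst hj1
    have h2 : q + 1 = 2 * Q := by omega
    have : p ∣ q + 1 := h2 ▸ hpQ.mul_left 2
    have := (Nat.dvd_add_right hpq).mp this
    exact hp.one_lt.ne' (Nat.dvd_one.mp this)

lemma ar_nonsplit_odd {p q n r s Q c : ℕ} (hp : p.Prime) (hq13 : 13 ≤ q) (hpq : p ∣ q)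
    (hpQ : p ∣ Q) (hr : q = 2 * r + 1) (hn : n = r + 1) (hc : c ∣ r) (hQ : 3 ≤ Q)
    (he : s * Q * n + 2 = s * Q * c + 2 * s * n) : q ≤ Q := by
  obtain ⟨k, hk⟩ := hc
  have hk0 : k ≠ 0 := by rintro rfl; simp at hk; omega
  have hc0 : c ≠ 0 := by rintro rfl; simp at hk; omega
  have hcr : c ≤ r := by rw [hk]; exact Nat.le_mul_of_pos_right _ (by omega)
  obtain ⟨e, hne⟩ := Nat.exists_eq_add_of_le (show c ≤ n by omega)
  rcases ar_s he with rfl | rfl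
  · exfalso
    have h1 : Q * e = 2 * r := by
      rw [hne] at he
      have : c + e = r + 1 := by omega
      nlinarith
    have : p ∣ 2 * r := h1 ▸ hpQ.mul_right e
    rw [hr] at hpq
    have := (Nat.dvd_add_right this).mp hpq
    exact hp.one_lt.ne' (Nat.dvd_one.mp this)
  · have h1 : Q * e = q := by
      rw [hne] at he
      have : c + e = r + 1 := by omega
      nlinarith
    have : k = 1 ∨ k = 2 ∨ 3 ≤ k := by omega
    rcases this with rfl | rfl | hk3
    · have : e = 1 := by omega
      subst this
      omega
    · exfalso
      have he' : e = c + 1 := by omega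
      have hq' : q = 4 * c + 1 := by omega
      rw [he', hq'] at h1
      have : Q < 4 := by by_contra h; nlinarith
      have : Q = 3 := by omega
      subst this
      omega
    · exfalso
      have h3 : c * 3 ≤ c * k := Nat.mul_le_mul_left _ hk3
      have : 3 * e ≤ Q * e := Nat.mul_le_mul_right _ hQ
      omega

lemma ar_nonsplit_even {q n s Q c : ℕ} (hq13 : 13 ≤ q)
    (hQ2 : 2 ∣ Q) (hn : n = q + 1) (hc : c ∣ q - 1) (hQ : 3 ≤ Q)
    (he : s * Q * n + 2 = s * Q * c + 2 * s * n) : q ≤ Q := by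
  obtain ⟨k, hk⟩ := hc
  have hk0 : k ≠ 0 := by rintro rfl; simp at hk; omega
  have hc0 : c ≠ 0 := by rintro rfl; simp at hk; omega
  have hcr : c ≤ q - 1 := by rw [hk]; exact Nat.le_mul_of_pos_right _ (by omega)
  obtain ⟨e, hne⟩ := Nat.exists_eq_add_of_le (show c ≤ n by omega)
  rcases ar_s he with rfl | rfl
  · have h1 : Q * e = 2 * q := by
      rw [hne] at he
      have : c + e = q + 1 := by omega
      nlinarith
    have : k = 1 ∨ 2 ≤ k := by omega
    rcases this with rfl | hk3
    · have : e = 2 := by omega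
      subst this
      omega
    · exfalso
      have h3 : c * 2 ≤ c * k := Nat.mul_le_mul_left _ hk3
      have : 4 * e ≤ Q * e := Nat.mul_le_mul_right _ (by omega)
      omega
  · exfalso
    have h1 : Q * e = 2 * q + 1 := by
      rw [hne] at he
      have : c + e = q + 1 := by omega
      nlinarith
    have : 2 ∣ 2 * q + 1 := h1 ▸ hQ2.mul_right e
    omega

lemma ar_d {p f q d : ℕ} (hp : p.Prime) (hf : f ≠ 0) (hq : q = p ^ f) (hq13 : 13 ≤ q)
    (hd : d = Nat.gcd 2 (q - 1)) :
    (d = 1 ∧ p = 2) ∨ (d = 2 ∧ ∃ r, q = 2 * r + 1) := by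
  rcases hp.eq_two_or_odd' with rfl | hodd
  · left
    refine ⟨?_, rfl⟩
    have : 2 ∣ q := hq ▸ dvd_pow_self 2 hf
    rw [hd]
    exact (Nat.coprime_two_left).mpr (by rw [Nat.odd_iff]; omega)
  · right
    have : Odd q := hq ▸ hodd.pow
    obtain ⟨r, hr⟩ := this
    refine ⟨?_, r, hr⟩
    rw [hd]
    exact Nat.gcd_eq_left ⟨r, by omega⟩

end Arith

section Final
open MulAction

variable {F L : Type} [Field F] [Field L] [Algebra F L]

theorem gen_main [Fintype F] [Finite L]
    (hroot : ∀ t : F, ∃ l : L, l ^ 2 - algebraMap F L t * l + 1 = 0)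
    (p f : ℕ) [hp : Fact p.Prime] [CharP F p] (hf : f ≠ 0) (hqf : Fintype.card F = p ^ f)
    (hq13 : 13 ≤ Fintype.card F) (d : ℕ) (hd : d = Nat.gcd 2 (Fintype.card F - 1))
    (H : Subgroup (ProjectiveSpecialLinearGroup (Fin 2) F)) (A : H)
    (hord : orderOf A = (Fintype.card F - 1) / d ∨ orderOf A = (Fintype.card F + 1) / d)
    (hcyc : ¬ IsCyclic H)
    (hstr : ¬ ∃ v : Fin 2 → F, v ≠ 0 ∧ ∀ A : SpecialLinearGroup (Fin 2) F,
      toPSL A ∈ H → ∃ c : F, (A : Matrix (Fin 2) (Fin 2) F).mulVec v = c • v)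
    (hdih : ¬ ∃ n : ℕ, Nonempty (H ≃* DihedralGroup n)) : H = ⊤ := by
  obtain ⟨q, hq⟩ : ∃ q, Fintype.card F = q := ⟨_, rfl⟩
  obtain ⟨n, hn⟩ : ∃ n, orderOf A = n := ⟨_, rfl⟩
  have hS := fun x : PLine F L => stab_struct p d hd H x
  have hT := fun (x : PLine F L) hr hc => top_of_uni H x hr hc hstr
  simp only [hq] at hS hT
  rw [hq] at hqf hq13 hd hord
  rw [hn] at hord
  have hpq : p ∣ q := hqf ▸ dvd_pow_self p hf
  have hdc := ar_d hp.out hf hqf hq13 hd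
  have hd2 : d ∣ 2 := hd ▸ Nat.gcd_dvd_left _ _
  have hdm : d ∣ q - 1 := hd ▸ Nat.gcd_dvd_right _ _
  have hdp : d ∣ q + 1 := by
    have : q + 1 = (q - 1) + 2 := by omega
    rw [this]; exact dvd_add hdm hd2
  obtain ⟨a, ha⟩ : ∃ a, (q - 1) / d = a := ⟨_, rfl⟩
  obtain ⟨b, hb⟩ : ∃ b, (q + 1) / d = b := ⟨_, rfl⟩
  have ha' : d * a = q - 1 := by rw [← ha, Nat.mul_div_cancel' hdm]
  have hb' : d * b = q + 1 := by rw [← hb, Nat.mul_div_cancel' hdp]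
  simp only [ha, hb] at hS hord
  have hab : a < b ∧ b ≤ a + 2 ∧ 6 ≤ a := by
    rcases hdc with ⟨rfl, _⟩ | ⟨rfl, _⟩ <;> omega
  have hn6 : 6 ≤ n := by omega
  have hcop : Nat.Coprime n p := by
    rw [Nat.coprime_comm, hp.out.coprime_iff_not_dvd]
    intro h
    have h1 : p ∣ q - 1 ∨ p ∣ q + 1 := by
      rcases hord with h2 | h2
      · left; rw [← ha', ← h2]; exact h.mul_left _
      · right; rw [← hb', ← h2]; exact h.mul_left _
    rcases h1 with h1 | h1
    · have h3 : p ∣ (q - 1) + 1 := by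
        rw [show q - 1 + 1 = q by omega]; exact hpq
      exact hp.out.one_lt.ne' (Nat.dvd_one.mp ((Nat.dvd_add_right h1).mp h3))
    · exact hp.out.one_lt.ne' (Nat.dvd_one.mp ((Nat.dvd_add_right hpq).mp h1))
  have hfix : ∀ h : H, h ≠ 1 → (fixedBy (PLine F L) h).ncard = 1 ∨
      (fixedBy (PLine F L) h).ncard = 2 := by
    intro h hh
    exact fix_ncard hroot (h : ProjectiveSpecialLinearGroup (Fin 2) F)
      (fun h1 => hh (Subtype.ext h1))
  have hA1 : A ≠ 1 := by rintro rfl; rw [orderOf_one] at hn; omega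
  have hnot1 : (fixedBy (PLine F L) A).ncard ≠ 1 := by
    intro h1
    obtain ⟨x, hx⟩ := Set.ncard_eq_one.mp h1
    obtain ⟨v, hv, rfl⟩ := exists_pt x
    obtain ⟨g, hg⟩ := toPSL_surj (A : ProjectiveSpecialLinearGroup (Fin 2) F)
    have hx' : fixedBy (PLine F L) (toPSL g) = {pt F v hv} := by rw [hg]; exact hx
    have hmem : pt F v hv ∈ fixedBy (PLine F L) (toPSL g) := by rw [hx']; rfl
    obtain ⟨l, hl⟩ := (smul_pt_iff g v v hv hv).mp hmem
    have hl2 := (uni_iff g v hv l hl).mpr (Or.inr hx')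
    obtain ⟨g', hg', hg'v⟩ := uni_lift g v l hl hl2
    have hgp := uni_pow p g' v hv hg'v
    have hAp : A ^ p = 1 := by
      apply Subtype.ext
      change (A : ProjectiveSpecialLinearGroup (Fin 2) F) ^ p = 1
      rw [← hg, ← hg']
      have : toPSL (g' ^ p) = toPSL g' ^ p := map_pow _ _ _
      rw [← this, hgp]; rfl
    have hdv : n ∣ p := hn ▸ orderOf_dvd_of_pow_eq_one hAp
    have := Nat.Coprime.eq_one_of_dvd hcop hdv
    omega
  obtain ⟨x1, x2, h12, hx⟩ := Set.ncard_eq_two.mp ((hfix A hA1).resolve_left hnot1)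
  have hfixA : ∀ y : PLine F L, A • y = y → y = x1 ∨ y = x2 := by
    intro y hy
    have : y ∈ fixedBy (PLine F L) A := hy
    rw [hx] at this
    simpa using this
  have hAx1 : A • x1 = x1 := by
    have : x1 ∈ fixedBy (PLine F L) A := by rw [hx]; simp
    exact this
  have hAx2 : A • x2 = x2 := by
    have : x2 ∈ fixedBy (PLine F L) A := by rw [hx]; simp
    exact this
  have hst : ∀ x : PLine F L, A • x = x → Nat.card (stabilizer H x) = uniCard H x * n ∧
      (uniCard H x = 1 ∨ (n = a ∧ RatPt x)) := by
    intro x hAx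
    obtain ⟨c, hc, ⟨k, hk⟩, hcase⟩ := hS x
    have hdv : n ∣ uniCard H x * c := by
      rw [← hc, ← hn]
      have h1 := Subgroup.orderOf_dvd_natCard (stabilizer H x) (x := A) hAx
      exact h1
    rw [hk] at hdv
    have hnc : n ∣ c := (Nat.Coprime.pow_right k hcop).dvd_of_dvd_mul_left hdv
    rcases hcase with ⟨hr, hca⟩ | ⟨hr, hu, hcb⟩
    · have hna : n = a := by
        rcases hord with h | h
        · exact h
        · have := Nat.le_of_dvd (by omega) (hnc.trans hca)
          omega
      have : c = n := Nat.dvd_antisymm (hna ▸ hca) hnc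
      rw [hc, this]
      exact ⟨rfl, Or.inr ⟨hna, hr⟩⟩
    · have hnb : n = b := by
        rcases hord with h | h
        · exfalso
          have h1 : a ∣ b := h ▸ (hnc.trans hcb)
          have h2 : a ∣ b - a := Nat.dvd_sub h1 dvd_rfl
          have := Nat.le_of_dvd (by omega) h2
          omega
        · exact h
      have : c = n := Nat.dvd_antisymm (hnb ▸ hcb) hnc
      rw [hc, this]
      exact ⟨rfl, Or.inl hu⟩
  have hbig : ∀ x y : PLine F L, x ≠ y → A • x = x → A • y = y → uniCard H x ≠ 1 → H = ⊤ := by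
    intro x y hxy hAx hAy hux
    obtain ⟨hna, hr⟩ := (hst x hAx).2.resolve_left hux
    apply hT x hr
    obtain ⟨c, hc, ⟨k, hk⟩, -⟩ := hS x
    have hdv := uni_dvd hfix A x y hxy hAx hAy
    rw [hn] at hdv
    exact ar_uni hp.out hf hqf hk hux hd2 (hna ▸ ha') hn6 hdv
  by_cases hu1 : uniCard H x1 = 1
  swap
  · exact hbig x1 x2 h12 hAx1 hAx2 hu1
  by_cases hu2 : uniCard H x2 = 1
  swap
  · exact hbig x2 x1 h12.symm hAx2 hAx1 hu2
  have hs1 := (hst x1 hAx1).1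
  have hs2 := (hst x2 hAx2).1
  rw [hu1, one_mul] at hs1
  rw [hu2, one_mul] at hs2
  have hc0 : ∀ x : PLine F L, ∃ c, Nat.card (stabilizer H x) = uniCard H x * c := by
    intro x
    obtain ⟨c, hc, -⟩ := hS x
    exact ⟨c, hc⟩
  rcases core n hn6 hfix hc0 A hn x1 x2 h12 hAx1 hAx2 hu1 hu2 hs1 hs2 with
    hcard | ⟨hcard, h, hh⟩ | ⟨x, s, c, hQ, hs, hc1, hc, he⟩
  · exfalso
    apply hcyc
    exact isCyclic_of_orderOf_eq_card A (by rw [hn, hcard])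
  · exfalso
    apply hdih
    refine ⟨n, swap_dihedral n (by omega) A h hn hcard x1 x2 h12 hAx1 hAx2 hfixA hs1 hs2 ?_ hh⟩
    intro g h1 h2
    apply Subtype.ext
    exact swap_sq (g : ProjectiveSpecialLinearGroup (Fin 2) F) x1 x2 h12 h1 h2
  · have hr : RatPt x := ratpt_of_uni H x (by omega)
    obtain ⟨c', hc', ⟨k, hk⟩, hcase⟩ := hS x
    have hcc : c = c' := by
      apply Nat.eq_of_mul_eq_mul_left (show 0 < uniCard H x by omega)
      rw [← hc, ← hc']
    subst hcc
    have hca : c ∣ a := by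
      rcases hcase with h | h
      · exact h.2
      · exact absurd hr h.1
    have hpQ : p ∣ uniCard H x := by
      rw [hk]; apply dvd_pow_self
      rintro rfl
      simp at hk; omega
    apply hT x hr
    rcases hord with h | h
    · exact (ar_split hn6 hQ hc1 (h ▸ hca) he).elim
    · rcases hdc with ⟨rfl, rfl⟩ | ⟨rfl, r, hr⟩
      · exact ar_nonsplit_even hq13 hpQ (by omega) (by rwa [← ha', one_mul]) hQ he
      · exact ar_nonsplit_odd hp.out hq13 hpq hpQ hr (by omega)
          (by rwa [show r = a by omega]) hQ he

lemma exists_ext (F : Type) [Field F] [Fintype F] : ∃ (L : Type) (_ : Field L) (_ : Algebra F L),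
    Finite L ∧ ∀ t : F, ∃ l : L, l ^ 2 - algebraMap F L t * l + 1 = 0 := by
  let P : F → Polynomial F := fun t => Polynomial.X ^ 2 - Polynomial.C t * Polynomial.X + 1
  have hdeg : ∀ t, (P t).degree = 2 := by
    intro t
    have : P t = Polynomial.C 1 * Polynomial.X ^ 2 + Polynomial.C (-t) * Polynomial.X +
        Polynomial.C 1 := by
      simp only [P, map_neg, map_one]; ring
    rw [this]
    exact Polynomial.degree_quadratic one_ne_zero
  have hne : ∀ t, P t ≠ 0 := by
    intro t h
    have := hdeg t
    rw [h] at this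
    simp at this
  let R : Polynomial F := ∏ t : F, P t
  have hR : R ≠ 0 := Finset.prod_ne_zero_iff.mpr (fun t _ => hne t)
  refine ⟨R.SplittingField, inferInstance, inferInstance, ?_, ?_⟩
  · exact Module.finite_of_finite F
  · intro t
    have hs : ((P t).map (algebraMap F R.SplittingField)).Splits := by
      refine Polynomial.Splits.of_dvd (Polynomial.SplittingField.splits R)
        (Polynomial.map_ne_zero hR) ?_
      exact Polynomial.map_dvd _ (Finset.dvd_prod_of_mem P (Finset.mem_univ t))
    obtain ⟨l, hl⟩ := hs.exists_eval_eq_zero (by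
      rw [Polynomial.degree_map, hdeg]; norm_num)
    refine ⟨l, ?_⟩
    simpa [P] using hl

end Final

/-- Dickson-type generation criterion for `PSL₂(q)`, `q ≥ 13`, `d = gcd(2, q−1)`:
if `A`, `B`, `AB` all have order `(q−1)/d`, or all have order `(q+1)/d`, and the subgroup
`H = ⟨A, B⟩` is not cyclic, not structural (conjugate into a Borel), not dihedral, not
isomorphic to `A₄`, `S₄` or `A₅`, and not a (proper) subfield subgroup `PSL₂(q₁)` or
`PGL₂(q₁)` with `q = q₁^m`, then `⟨A, B⟩ = PSL₂(q)`. -/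
theorem psl2_generation_of_orders (F : Type) [Field F] [Fintype F] (q : ℕ)
    (hq : Fintype.card F = q) (hq13 : 13 ≤ q) (d : ℕ) (hd : d = Nat.gcd 2 (q - 1))
    (A B : ProjectiveSpecialLinearGroup (Fin 2) F)
    (horders :
      (orderOf A = (q - 1) / d ∧ orderOf B = (q - 1) / d ∧ orderOf (A * B) = (q - 1) / d) ∨
      (orderOf A = (q + 1) / d ∧ orderOf B = (q + 1) / d ∧ orderOf (A * B) = (q + 1) / d))
    (hcyc : ¬ IsCyclic (Subgroup.closure {A, B}))
    (hstr : ¬ IsStructural F (Subgroup.closure {A, B}))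
    (hdih : ¬ ∃ n : ℕ, Nonempty ((Subgroup.closure {A, B}) ≃* DihedralGroup n))
    (hA4 : ¬ Nonempty ((Subgroup.closure {A, B}) ≃* alternatingGroup (Fin 4)))
    (hS4 : ¬ Nonempty ((Subgroup.closure {A, B}) ≃* Equiv.Perm (Fin 4)))
    (hA5 : ¬ Nonempty ((Subgroup.closure {A, B}) ≃* alternatingGroup (Fin 5)))
    (hsub : ¬ ∃ (K : Type) (_ : Field K) (_ : Fintype K) (m : ℕ), 2 ≤ m ∧
      Fintype.card F = Fintype.card K ^ m ∧
      (Nonempty ((Subgroup.closure {A, B}) ≃* ProjectiveSpecialLinearGroup (Fin 2) K) ∨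
        Nonempty ((Subgroup.closure {A, B}) ≃* ProjGL2 K))) :
    Subgroup.closure {A, B} = ⊤ := by
  obtain ⟨p, hchar⟩ := CharP.exists F
  obtain ⟨f, hp, hpf⟩ := FiniteField.card F p
  have : Fact p.Prime := ⟨hp⟩
  obtain ⟨L, _, _, hfin, hroot⟩ := exists_ext F
  subst hq
  have hAmem : A ∈ Subgroup.closure {A, B} := Subgroup.subset_closure (by simp)
  refine gen_main (L := L) hroot p f f.ne_zero hpf hq13 d hd (Subgroup.closure {A, B})
    ⟨A, hAmem⟩ ?_ hcyc hstr hdih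
  rw [Subgroup.orderOf_mk]
  rcases horders with h | h
  · exact Or.inl h.1
  · exact Or.inr h.1
end
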